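/- arXiv:1103.1812 — 4 statements merged into one kernel-verified Lean document; each statement's English description precedes it below -/
import Mathlib

section
/- For the free Lie algebra F on n generators over a field, the dimension of the quotient F^d/F^{d+1} of consecutive terms of the lower central series equals Witt's number l_n(d) = (1/d) * sum over divisors m of d of mu(m) * n^(d/m), where mu is the Möbius function. -/
open LieModule Finset

/-- Witt's dimension function `l_n(d) = (1/d) ∑_{m ∣ d} μ(m) n^{d/m}`. -/
noncomputable def lWitt (n d : ℕ) : ℚ :=
  (1 / d) * ∑ m ∈ d.divisors, (ArithmeticFunction.moebius m : ℚ) * (n : ℚ) ^ (d / m)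

/-- The quotient `A/B` of two Lie ideals, regarded as a module. -/
abbrev lieIdealQuot (K : Type*) {L : Type*} [Field K] [LieRing L] [LieAlgebra K L]
    (A B : LieIdeal K L) : Type _ :=
  A.toSubmodule ⧸ (B.toSubmodule.comap A.toSubmodule.subtype)

/-- The Schur multiplier `M(L) = (F² ⊓ R)/[F,R]` computed from a free presentation
`L ≅ F/R`, where `R` is the kernel of the presentation. -/
abbrev schurMult (K : Type*) {F : Type*} [Field K] [LieRing F] [LieAlgebra K F]
    (R : LieIdeal K F) : Type _ :=
  lieIdealQuot K (lowerCentralSeries K F F 1 ⊓ R) ⁅(⊤ : LieIdeal K F), R⁆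

namespace WittDim

section Dual
variable (K L : Type) [Field K] [LieRing L] [LieAlgebra K L]

/-- The Lie algebra `L[ε]`. -/
def Dual (_K L : Type) : Type := L × L

instance : AddCommGroup (Dual K L) := inferInstanceAs (AddCommGroup (L × L))
instance : Module K (Dual K L) := inferInstanceAs (Module K (L × L))

instance : LieRing (Dual K L) where
  bracket a b := (⁅a.1, b.1⁆, ⁅a.1, b.2⁆ + ⁅a.2, b.1⁆)
  add_lie a b c := by
    refine Prod.ext (add_lie a.1 b.1 c.1) ?_
    change ⁅a.1 + b.1, c.2⁆ + ⁅a.2 + b.2, c.1⁆ = (⁅a.1, c.2⁆ + ⁅a.2, c.1⁆) + (⁅b.1, c.2⁆ + ⁅b.2, c.1⁆)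
    rw [add_lie, add_lie]; abel
  lie_add a b c := by
    refine Prod.ext (lie_add a.1 b.1 c.1) ?_
    change ⁅a.1, b.2 + c.2⁆ + ⁅a.2, b.1 + c.1⁆ = (⁅a.1, b.2⁆ + ⁅a.2, b.1⁆) + (⁅a.1, c.2⁆ + ⁅a.2, c.1⁆)
    rw [lie_add, lie_add]; abel
  lie_self a := by
    refine Prod.ext (lie_self a.1) ?_
    change ⁅a.1, a.2⁆ + ⁅a.2, a.1⁆ = 0
    rw [← lie_skew a.1 a.2]; exact neg_add_cancel _
  leibniz_lie a b c := by
    refine Prod.ext (leibniz_lie a.1 b.1 c.1) ?_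
    change ⁅a.1, ⁅b.1, c.2⁆ + ⁅b.2, c.1⁆⁆ + ⁅a.2, ⁅b.1, c.1⁆⁆ =
      (⁅⁅a.1, b.1⁆, c.2⁆ + ⁅⁅a.1, b.2⁆ + ⁅a.2, b.1⁆, c.1⁆) +
      (⁅b.1, ⁅a.1, c.2⁆ + ⁅a.2, c.1⁆⁆ + ⁅b.2, ⁅a.1, c.1⁆⁆)
    rw [lie_add, lie_add, add_lie, leibniz_lie a.1 b.1 c.2, leibniz_lie a.1 b.2 c.1,
      leibniz_lie a.2 b.1 c.1]
    abel

instance : LieAlgebra K (Dual K L) where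
  lie_smul t a b := by
    refine Prod.ext (lie_smul t a.1 b.1) ?_
    change ⁅a.1, t • b.2⁆ + ⁅a.2, t • b.1⁆ = t • (⁅a.1, b.2⁆ + ⁅a.2, b.1⁆)
    rw [lie_smul, lie_smul, smul_add]

/-- Constructor. -/
def Dual.mk (a b : L) : Dual K L := (a, b)

/-- First projection. -/
def Dual.fst : Dual K L →ₗ⁅K⁆ L where
  toFun a := a.1
  map_add' _ _ := rfl
  map_smul' _ _ := rfl
  map_lie' := rfl

/-- Second projection. -/
def Dual.snd : Dual K L →ₗ[K] L where
  toFun a := a.2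
  map_add' _ _ := rfl
  map_smul' _ _ := rfl

theorem Dual.snd_lie (a b : Dual K L) : Dual.snd K L ⁅a, b⁆ =
    ⁅Dual.fst K L a, Dual.snd K L b⁆ + ⁅Dual.snd K L a, Dual.fst K L b⁆ := rfl

end Dual

variable {K : Type} [Field K]

/-- Induction: a submodule closed under brackets containing generators is everything. -/
theorem free_induction {X : Type} (S : Submodule K (FreeLieAlgebra K X))
    (hof : ∀ x, FreeLieAlgebra.of K x ∈ S)
    (hlie : ∀ a ∈ S, ∀ b ∈ S, ⁅a, b⁆ ∈ S) (a : FreeLieAlgebra K X) : a ∈ S := by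
  let S' : LieSubalgebra K (FreeLieAlgebra K X) :=
    { S with lie_mem' := fun {a b} ha hb => hlie a ha b hb }
  let g : FreeLieAlgebra K X →ₗ⁅K⁆ S' :=
    FreeLieAlgebra.lift K (fun x => (⟨FreeLieAlgebra.of K x, hof x⟩ : S'))
  have h : S'.incl.comp g = LieHom.id := by
    ext x
    simp [g]
  have h2 : ((g a : S') : FreeLieAlgebra K X) = a := by
    simpa using LieHom.congr_fun h a
  rw [← h2]
  exact (g a).2

/-- Derivation of the free Lie algebra extending a map on generators. -/
theorem exists_derivation {X : Type} (f : X → FreeLieAlgebra K X) :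
    ∃ D : FreeLieAlgebra K X →ₗ[K] FreeLieAlgebra K X,
      (∀ x, D (FreeLieAlgebra.of K x) = f x) ∧
      ∀ a b, D ⁅a, b⁆ = ⁅a, D b⁆ + ⁅D a, b⁆ := by
  let g : FreeLieAlgebra K X →ₗ⁅K⁆ Dual K (FreeLieAlgebra K X) :=
    FreeLieAlgebra.lift K (fun x => Dual.mk K _ (FreeLieAlgebra.of K x) (f x))
  have h : (Dual.fst K _).comp g = LieHom.id := by
    ext x
    simp only [g, LieHom.comp_apply, FreeLieAlgebra.lift_of_apply]
    rfl
  have h' : ∀ a, Dual.fst K _ (g a) = a := fun a => by simpa using LieHom.congr_fun h a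
  refine ⟨(Dual.snd K _).comp (g : FreeLieAlgebra K X →ₗ[K] _), ?_, ?_⟩
  · intro x
    simp only [g, LinearMap.comp_apply, LieHom.coe_toLinearMap, FreeLieAlgebra.lift_of_apply]
    rfl
  · intro a b
    simp only [LinearMap.comp_apply, LieHom.coe_toLinearMap, LieHom.map_lie, Dual.snd_lie, h']

section Semi
variable {L : Type} [LieRing L] [LieAlgebra K L]

/-- A derivation. -/
structure Der (K L : Type) [Field K] [LieRing L] [LieAlgebra K L] where
  D : L →ₗ[K] L
  leib : ∀ a b, D ⁅a, b⁆ = ⁅a, D b⁆ + ⁅D a, b⁆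

/-- The semidirect product of `L` with the line spanned by a derivation. -/
def Semi (_δ : Der K L) : Type := L × K

variable (δ : Der K L)
instance : AddCommGroup (Semi δ) := inferInstanceAs (AddCommGroup (L × K))
instance : Module K (Semi δ) := inferInstanceAs (Module K (L × K))

instance : LieRing (Semi δ) where
  bracket a b := (⁅a.1, b.1⁆ + (a.2 • δ.D b.1 - b.2 • δ.D a.1), 0)
  add_lie a b c := by
    refine Prod.ext ?_ (add_zero _).symm
    change ⁅a.1 + b.1, c.1⁆ + ((a.2 + b.2) • δ.D c.1 - c.2 • δ.D (a.1 + b.1)) =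
      ⁅a.1, c.1⁆ + (a.2 • δ.D c.1 - c.2 • δ.D a.1) + (⁅b.1, c.1⁆ + (b.2 • δ.D c.1 - c.2 • δ.D b.1))
    rw [add_lie, map_add]; module
  lie_add a b c := by
    refine Prod.ext ?_ (add_zero _).symm
    change ⁅a.1, b.1 + c.1⁆ + (a.2 • δ.D (b.1 + c.1) - (b.2 + c.2) • δ.D a.1) =
      ⁅a.1, b.1⁆ + (a.2 • δ.D b.1 - b.2 • δ.D a.1) + (⁅a.1, c.1⁆ + (a.2 • δ.D c.1 - c.2 • δ.D a.1))
    rw [lie_add, map_add]; module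
  lie_self a := by
    refine Prod.ext ?_ rfl
    change ⁅a.1, a.1⁆ + (a.2 • δ.D a.1 - a.2 • δ.D a.1) = 0
    simp
  leibniz_lie a b c := by
    refine Prod.ext ?_ (add_zero _).symm
    change ⁅a.1, ⁅b.1, c.1⁆ + (b.2 • δ.D c.1 - c.2 • δ.D b.1)⁆ +
        (a.2 • δ.D (⁅b.1, c.1⁆ + (b.2 • δ.D c.1 - c.2 • δ.D b.1)) - (0 : K) • δ.D a.1) =
      ⁅⁅a.1, b.1⁆ + (a.2 • δ.D b.1 - b.2 • δ.D a.1), c.1⁆ +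
        ((0 : K) • δ.D c.1 - c.2 • δ.D (⁅a.1, b.1⁆ + (a.2 • δ.D b.1 - b.2 • δ.D a.1))) +
      (⁅b.1, ⁅a.1, c.1⁆ + (a.2 • δ.D c.1 - c.2 • δ.D a.1)⁆ +
        (b.2 • δ.D (⁅a.1, c.1⁆ + (a.2 • δ.D c.1 - c.2 • δ.D a.1)) - (0 : K) • δ.D b.1))
    simp only [lie_add, add_lie, lie_sub, sub_lie, lie_smul, smul_lie, map_add, map_sub, map_smul,
      δ.leib, leibniz_lie a.1 b.1 c.1]
    rw [← lie_skew b.1 (δ.D a.1)]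
    module

instance : LieAlgebra K (Semi δ) where
  lie_smul t a b := by
    refine Prod.ext ?_ (smul_zero _).symm
    change ⁅a.1, t • b.1⁆ + (a.2 • δ.D (t • b.1) - (t • b.2) • δ.D a.1) =
      t • (⁅a.1, b.1⁆ + (a.2 • δ.D b.1 - b.2 • δ.D a.1))
    rw [lie_smul, map_smul, smul_eq_mul]; module

/-- Constructor. -/
def Semi.mk (a : L) (s : K) : Semi δ := (a, s)

theorem Semi.lie_mk (a b : L) (s t : K) :
    ⁅Semi.mk δ a s, Semi.mk δ b t⁆ = Semi.mk δ (⁅a, b⁆ + (s • δ.D b - t • δ.D a)) 0 := rfl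

theorem Semi.lie_def (a b : Semi δ) :
    ⁅a, b⁆ = ((⁅a.1, b.1⁆ + (a.2 • δ.D b.1 - b.2 • δ.D a.1), 0) : L × K) := rfl

/-- Inclusion of `L`. -/
def Semi.inl : L →ₗ⁅K⁆ Semi δ where
  toFun a := Semi.mk δ a 0
  map_add' a b := Prod.ext rfl (add_zero _).symm
  map_smul' t a := Prod.ext rfl (smul_zero _).symm
  map_lie' {a b} := by
    rw [Semi.lie_mk]
    simp

/-- The identity as linear map. -/
def Semi.toProd : Semi δ ≃ₗ[K] L × K := LinearEquiv.refl K (L × K)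

/-- Lie homs from the semidirect product. -/
def Semi.lift {M : Type} [LieRing M] [LieAlgebra K M] (ψ : L →ₗ⁅K⁆ M) (m : M)
    (h : ∀ a, ψ (δ.D a) = ⁅m, ψ a⁆) : Semi δ →ₗ⁅K⁆ M where
  toFun a := ψ a.1 + a.2 • m
  map_add' a b := by
    change ψ (a.1 + b.1) + (a.2 + b.2) • m = _
    rw [map_add]; module
  map_smul' t a := by
    change ψ (t • a.1) + (t • a.2) • m = t • (ψ a.1 + a.2 • m)
    rw [map_smul, smul_eq_mul]; module
  map_lie' {a b} := by
    change ψ (⁅a.1, b.1⁆ + (a.2 • δ.D b.1 - b.2 • δ.D a.1)) + (0 : K) • m =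
      ⁅ψ a.1 + a.2 • m, ψ b.1 + b.2 • m⁆
    simp only [map_add, map_sub, map_smul, h, LieHom.map_lie, lie_add, add_lie, smul_lie, lie_smul,
      lie_self]
    rw [← lie_skew m (ψ a.1)]
    module

end Semi

/-! ### Filtration by weight -/

/-- `Mono wt a i`: `a` is a bracket monomial of weight `i`. -/
inductive Mono {X : Type} (wt : X → ℕ) : FreeLieAlgebra K X → ℕ → Prop
  | of (x : X) : Mono wt (FreeLieAlgebra.of K x) (wt x)
  | lie {a b : FreeLieAlgebra K X} {i j : ℕ} : Mono wt a i → Mono wt b j → Mono wt ⁅a, b⁆ (i + j)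

/-- The span of the bracket monomials of weight at least `k`. -/
noncomputable def W (K : Type) [Field K] {X : Type} (wt : X → ℕ) (k : ℕ) : Submodule K (FreeLieAlgebra K X) :=
  Submodule.span K {a | ∃ i, k ≤ i ∧ Mono wt a i}

theorem W_anti {X : Type} (wt : X → ℕ) {i j : ℕ} (h : i ≤ j) : W K wt j ≤ W K wt i :=
  Submodule.span_mono fun _ ⟨m, hm, h2⟩ => ⟨m, h.trans hm, h2⟩

theorem of_mem_W {X : Type} (wt : X → ℕ) (x : X) : FreeLieAlgebra.of K x ∈ W K wt (wt x) :=
  Submodule.subset_span ⟨_, le_rfl, Mono.of x⟩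

theorem lie_mem_W {X : Type} (wt : X → ℕ) {i j : ℕ} {a b : FreeLieAlgebra K X}
    (ha : a ∈ W K wt i) (hb : b ∈ W K wt j) : ⁅a, b⁆ ∈ W K wt (i + j) := by
  induction ha using Submodule.span_induction with
  | zero => simp
  | add x y _ _ hx hy => rw [add_lie]; exact add_mem hx hy
  | smul t x _ hx => rw [smul_lie]; exact Submodule.smul_mem _ _ hx
  | mem a ha =>
    obtain ⟨m, hm, hma⟩ := ha
    induction hb using Submodule.span_induction with
    | zero => simp
    | add x y _ _ hx hy => rw [lie_add]; exact add_mem hx hy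
    | smul t x _ hx => rw [lie_smul]; exact Submodule.smul_mem _ _ hx
    | mem b hb =>
      obtain ⟨p, hp, hpb⟩ := hb
      exact Submodule.subset_span ⟨_, add_le_add hm hp, Mono.lie hma hpb⟩

/-- Universal property of the filtration. -/
theorem W_map {X M : Type} [LieRing M] [LieAlgebra K M] (wt : X → ℕ)
    (φ : FreeLieAlgebra K X →ₗ⁅K⁆ M) (R : ℕ → Submodule K M)
    (hanti : ∀ i j, i ≤ j → R j ≤ R i)
    (hof : ∀ x, φ (FreeLieAlgebra.of K x) ∈ R (wt x))
    (hlie : ∀ i j a b, a ∈ R i → b ∈ R j → ⁅a, b⁆ ∈ R (i + j)) {k : ℕ} {a : FreeLieAlgebra K X}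
    (ha : a ∈ W K wt k) : φ a ∈ R k := by
  have key : ∀ (a : FreeLieAlgebra K X) i, Mono wt a i → φ a ∈ R i := by
    intro a i h
    induction h with
    | of x => exact hof x
    | lie _ _ h1 h2 => rw [LieHom.map_lie]; exact hlie _ _ _ _ h1 h2
  induction ha using Submodule.span_induction with
  | zero => simp
  | add x y _ _ hx hy => rw [map_add]; exact add_mem hx hy
  | smul t x _ hx => rw [map_smul]; exact Submodule.smul_mem _ _ hx
  | mem a ha =>
    obtain ⟨m, hm, hma⟩ := ha
    exact hanti _ _ hm (key _ _ hma)

theorem W_eq_top {X : Type} (wt : X → ℕ) (k : ℕ) (h : ∀ x, k ≤ wt x) : W K wt k = ⊤ := by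
  rw [eq_top_iff]
  intro a _
  refine free_induction _ (fun x => W_anti wt (h x) (of_mem_W wt x)) (fun a ha b hb => ?_) a
  exact W_anti wt (Nat.le_add_right k k) (lie_mem_W wt ha hb)

/-- The graded pieces. -/
abbrev Gr (K : Type) [Field K] {X : Type} (wt : X → ℕ) (d : ℕ) : Type :=
  (W K wt d) ⧸ ((W K wt (d + 1)).comap (W K wt d).subtype)

/-! ### Lazard elimination -/

section Elim
variable {X : Type} (x : X)

/-- The new alphabet. -/
abbrev Al (x : X) : Type := ℕ × {y : X // y ≠ x}

/-- The new weights. -/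
def wt' (wt : X → ℕ) : Al x → ℕ := fun p => p.1 * wt x + wt p.2

theorem exists_der : ∃ δ : Der K (FreeLieAlgebra K (Al x)),
    ∀ p : Al x, δ.D (FreeLieAlgebra.of K p) = FreeLieAlgebra.of K ((p.1 + 1, p.2) : Al x) := by
  obtain ⟨D, h1, h2⟩ := exists_derivation (K := K) (X := Al x)
    (fun p => FreeLieAlgebra.of K ((p.1 + 1, p.2) : Al x))
  exact ⟨⟨D, h2⟩, h1⟩

theorem elim_exists (wt : X → ℕ) : ∃ e : FreeLieAlgebra K X ≃ₗ[K] FreeLieAlgebra K (Al x) × K,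
    ∀ d a, a ∈ W K wt d ↔ ((e a).1 ∈ W K (wt' x wt) d ∧ (wt x < d → (e a).2 = 0)) := by
  classical
  obtain ⟨δ, hδ⟩ := exists_der (K := K) x
  have hδW : ∀ d a, a ∈ W K (wt' x wt) d → δ.D a ∈ W K (wt' x wt) (wt x + d) := by
    have key : ∀ (a : FreeLieAlgebra K (Al x)) i, Mono (wt' x wt) a i →
        δ.D a ∈ W K (wt' x wt) (wt x + i) := by
      intro a i h
      induction h with
      | of p =>
        rw [hδ]
        have := of_mem_W (K := K) (wt' x wt) ((p.1 + 1, p.2) : Al x)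
        convert this using 2
        simp only [wt']; ring
      | @lie a b i j ha hb h1 h2 =>
        rw [δ.leib]
        refine add_mem ?_ ?_
        · have := lie_mem_W _ (Submodule.subset_span ⟨i, le_rfl, ha⟩ : a ∈ W K (wt' x wt) i) h2
          convert this using 2; ring
        · have := lie_mem_W _ h1 (Submodule.subset_span ⟨j, le_rfl, hb⟩ : b ∈ W K (wt' x wt) j)
          convert this using 2; ring
    intro d a ha
    induction ha using Submodule.span_induction with
    | zero => simp
    | add x y _ _ hx hy => rw [map_add]; exact add_mem hx hy
    | smul t x _ hx => rw [map_smul]; exact Submodule.smul_mem _ _ hx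
    | mem a ha =>
      obtain ⟨m, hm, hma⟩ := ha
      exact W_anti _ (by omega) (key _ _ hma)
  let ad : FreeLieAlgebra K X → FreeLieAlgebra K X := fun a => ⁅FreeLieAlgebra.of K x, a⁆
  let ψ : FreeLieAlgebra K (Al x) →ₗ⁅K⁆ FreeLieAlgebra K X :=
    FreeLieAlgebra.lift K (fun p => ad^[p.1] (FreeLieAlgebra.of K p.2.1))
  have hψof : ∀ p : Al x, ψ (FreeLieAlgebra.of K p) = ad^[p.1] (FreeLieAlgebra.of K p.2.1) :=
    fun p => FreeLieAlgebra.lift_of_apply _ _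
  have hψ : ∀ a, ψ (δ.D a) = ⁅FreeLieAlgebra.of K x, ψ a⁆ := by
    let S : Submodule K (FreeLieAlgebra K (Al x)) :=
      { carrier := {a | ψ (δ.D a) = ⁅FreeLieAlgebra.of K x, ψ a⁆}
        zero_mem' := by simp
        add_mem' := by
          intro a b ha hb
          simp only [Set.mem_ofPred_eq] at *
          simp [ha, hb]
        smul_mem' := by
          intro t a ha
          simp only [Set.mem_ofPred_eq] at *
          simp [ha] }
    refine free_induction S ?_ ?_
    · intro p
      change ψ (δ.D _) = ⁅FreeLieAlgebra.of K x, ψ _⁆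
      rw [hδ, hψof, hψof, Function.iterate_succ_apply']
    · intro a ha b hb
      change ψ (δ.D _) = ⁅FreeLieAlgebra.of K x, ψ _⁆
      replace ha : ψ (δ.D _) = ⁅FreeLieAlgebra.of K x, ψ _⁆ := ha
      replace hb : ψ (δ.D _) = ⁅FreeLieAlgebra.of K x, ψ _⁆ := hb
      rw [δ.leib, map_add, LieHom.map_lie, LieHom.map_lie, ha, hb, LieHom.map_lie,
        leibniz_lie (FreeLieAlgebra.of K x) (ψ a) (ψ b), add_comm]
  let Ψ : Semi δ →ₗ⁅K⁆ FreeLieAlgebra K X := Semi.lift δ ψ (FreeLieAlgebra.of K x) hψ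
  have hΨ : ∀ a s, Ψ (Semi.mk δ a s) = ψ a + s • FreeLieAlgebra.of K x := fun a s => rfl
  let Φ : FreeLieAlgebra K X →ₗ⁅K⁆ Semi δ := FreeLieAlgebra.lift K (fun y =>
    if h : y = x then Semi.mk δ 0 1 else Semi.mk δ (FreeLieAlgebra.of K ((0, ⟨y, h⟩) : Al x)) 0)
  have hΦx : Φ (FreeLieAlgebra.of K x) = Semi.mk δ 0 1 := by
    simp [Φ]
  have hΦy : ∀ y (h : y ≠ x), Φ (FreeLieAlgebra.of K y) =
      Semi.mk δ (FreeLieAlgebra.of K ((0, ⟨y, h⟩) : Al x)) 0 := by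
    intro y h
    simp [Φ, h]
  have hΨΦ : Ψ.comp Φ = LieHom.id := by
    ext y
    by_cases h : y = x
    · subst h
      rw [LieHom.comp_apply, hΦx, hΨ]
      simp
    · rw [LieHom.comp_apply, hΦy y h, hΨ, hψof]
      simp
  have hΦψ : Φ.comp ψ = Semi.inl δ := by
    ext p
    obtain ⟨i, y⟩ := p
    rw [LieHom.comp_apply, hψof]
    change Φ (ad^[i] (FreeLieAlgebra.of K y.1)) = Semi.mk δ (FreeLieAlgebra.of K ((i, y) : Al x)) 0
    induction i with
    | zero => exact hΦy y.1 y.2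
    | succ i ih =>
      rw [Function.iterate_succ_apply']
      change Φ ⁅_, _⁆ = _
      rw [LieHom.map_lie, ih, hΦx, Semi.lie_mk, hδ]
      simp
  have h1 : ∀ a, Ψ (Φ a) = a := fun a => by simpa using LieHom.congr_fun hΨΦ a
  have h2 : ∀ a, Φ (Ψ a) = a := by
    intro a
    have : Ψ a = ψ a.1 + a.2 • FreeLieAlgebra.of K x := rfl
    rw [this, map_add, map_smul, hΦx]
    have h3 : Φ (ψ a.1) = Semi.inl δ a.1 := LieHom.congr_fun hΦψ a.1
    rw [h3]
    refine Prod.ext ?_ ?_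
    · change a.1 + a.2 • 0 = a.1
      simp
    · change 0 + a.2 • 1 = a.2
      simp
  let e0 : FreeLieAlgebra K X ≃ₗ[K] Semi δ :=
    LinearEquiv.ofLinearMap (Φ : FreeLieAlgebra K X →ₗ[K] Semi δ) (Ψ : Semi δ →ₗ[K] _)
      (LinearMap.ext h2) (LinearMap.ext h1)
  let R : ℕ → Submodule K (Semi δ) := fun d =>
    { carrier := {a | a.1 ∈ W K (wt' x wt) d ∧ (wt x < d → a.2 = 0)}
      zero_mem' := ⟨zero_mem (W K (wt' x wt) d), fun _ => rfl⟩
      add_mem' := by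
        intro a b ha hb
        refine ⟨add_mem ha.1 hb.1, fun h => ?_⟩
        change a.2 + b.2 = 0
        rw [ha.2 h, hb.2 h, add_zero]
      smul_mem' := by
        intro t a ha
        refine ⟨Submodule.smul_mem _ t ha.1, fun h => ?_⟩
        change t • a.2 = 0
        rw [ha.2 h, smul_zero] }
  have hD : ∀ i j (a b : Semi δ), a ∈ R i → b ∈ R j →
      a.2 • δ.D b.1 ∈ W K (wt' x wt) (i + j) := by
    intro i j a b ha hb
    by_cases h : wt x < i
    · rw [ha.2 h]; simp
    · exact Submodule.smul_mem _ _ (W_anti _ (by omega) (hδW _ _ hb.1))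
  refine ⟨e0.trans (Semi.toProd δ), fun d a => ⟨fun ha => ?_, fun ha => ?_⟩⟩
  · have : Φ a ∈ R d := by
      refine W_map wt Φ R ?_ ?_ ?_ ha
      · intro i j hij a ha
        exact ⟨W_anti _ hij ha.1, fun h => ha.2 (by omega)⟩
      · intro y
        by_cases h : y = x
        · subst h
          rw [hΦx]
          exact ⟨zero_mem (W K (wt' y wt) _), fun h => absurd h (lt_irrefl _)⟩
        · rw [hΦy y h]
          refine ⟨?_, fun _ => rfl⟩
          have := of_mem_W (K := K) (wt' x wt) ((0, ⟨y, h⟩) : Al x)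
          change FreeLieAlgebra.of K ((0, ⟨y, h⟩) : Al x) ∈ _
          simpa [wt'] using this
      · intro i j a b ha hb
        refine ⟨?_, fun _ => rfl⟩
        change ⁅a.1, b.1⁆ + (a.2 • δ.D b.1 - b.2 • δ.D a.1) ∈ _
        refine add_mem (lie_mem_W _ ha.1 hb.1) (sub_mem (hD i j a b ha hb) ?_)
        rw [add_comm]
        exact hD j i b a hb ha
    exact this
  · replace ha : Φ a ∈ R d := ha
    rw [← h1 a]
    change ψ (Φ a).1 + (Φ a).2 • FreeLieAlgebra.of K x ∈ _
    refine add_mem ?_ ?_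
    · refine W_map (wt' x wt) ψ (W K wt) (fun i j h => W_anti wt h) ?_
        (fun i j a b => lie_mem_W wt) ha.1
      intro p
      obtain ⟨i, y⟩ := p
      rw [hψof]
      change ad^[i] (FreeLieAlgebra.of K y.1) ∈ W K wt (i * wt x + wt y)
      induction i with
      | zero => simpa using of_mem_W wt y.1
      | succ i ih =>
        rw [Function.iterate_succ_apply']
        have := lie_mem_W wt (of_mem_W (K := K) wt x) ih
        convert this using 2; ring
    · by_cases h : wt x < d
      · rw [ha.2 h]; simp
      · exact Submodule.smul_mem _ _ (W_anti _ (by omega) (of_mem_W wt x))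

end Elim

theorem Gr_step {X : Type} (x : X) (wt : X → ℕ) (d : ℕ)
    (hfin : Module.Finite K (Gr K (wt' x wt) d)) :
    Module.Finite K (Gr K wt d) ∧
    Module.finrank K (Gr K wt d) =
      Module.finrank K (Gr K (wt' x wt) d) + if d = wt x then 1 else 0 := by
  obtain ⟨e, he⟩ := elim_exists (K := K) x wt
  let p1 : W K wt d →ₗ[K] W K (wt' x wt) d :=
    LinearMap.codRestrict _ ((LinearMap.fst K _ _).comp (e.toLinearMap.comp (W K wt d).subtype))
      (fun a => ((he d a.1).1 a.2).1)
  have hp1 : ∀ a, (p1 a : FreeLieAlgebra K (Al x)) = (e a.1).1 := fun a => rfl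
  let q : W K wt d →ₗ[K] Gr K (wt' x wt) d := (Submodule.mkQ _).comp p1
  have hq : ∀ a, q a = 0 ↔ (e a.1).1 ∈ W K (wt' x wt) (d + 1) := by
    intro a
    change Submodule.Quotient.mk (p1 a) = 0 ↔ _
    rw [Submodule.Quotient.mk_eq_zero]
    rfl
  by_cases h : d = wt x
  · let r : W K wt d →ₗ[K] Gr K (wt' x wt) d × K :=
      q.prod ((LinearMap.snd K _ _).comp (e.toLinearMap.comp (W K wt d).subtype))
    have hker : LinearMap.ker r = (W K wt (d + 1)).comap (W K wt d).subtype := by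
      ext a
      rw [LinearMap.mem_ker, Submodule.mem_comap, Submodule.subtype_apply, he (d + 1), ← hq]
      change (q a, (e a.1).2) = 0 ↔ _
      rw [Prod.mk_eq_zero]
      have : wt x < d + 1 := by omega
      simp [this]
    have hsurj : Function.Surjective r := by
      rintro ⟨b, s⟩
      obtain ⟨b, rfl⟩ := Submodule.mkQ_surjective _ b
      have hm : e.symm (b.1, s) ∈ W K wt d := by
        rw [he]
        rw [LinearEquiv.apply_symm_apply]
        exact ⟨b.2, fun h' => by omega⟩
      refine ⟨⟨e.symm (b.1, s), hm⟩, ?_⟩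
      change (Submodule.mkQ _ (p1 _), (e (e.symm (b.1, s))).2) = _
      have : p1 ⟨e.symm (b.1, s), hm⟩ = b := by
        apply Subtype.ext
        rw [hp1]; simp
      rw [this]; simp
    have E : Gr K wt d ≃ₗ[K] Gr K (wt' x wt) d × K :=
      (Submodule.quotEquivOfEq _ _ hker.symm).trans (r.quotKerEquivOfSurjective hsurj)
    refine ⟨Module.Finite.equiv E.symm, ?_⟩
    rw [E.finrank_eq, Module.finrank_prod, Module.finrank_self, if_pos h]
  · have hker : LinearMap.ker q = (W K wt (d + 1)).comap (W K wt d).subtype := by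
      ext a
      rw [LinearMap.mem_ker, Submodule.mem_comap, Submodule.subtype_apply, he (d + 1), ← hq]
      have := ((he d a.1).1 a.2).2
      refine ⟨fun h1 => ⟨h1, fun h2 => this (by omega)⟩, fun h1 => h1.1⟩
    have hsurj : Function.Surjective q := by
      intro b
      obtain ⟨b, rfl⟩ := Submodule.mkQ_surjective _ b
      have hm : e.symm (b.1, 0) ∈ W K wt d := by
        rw [he]
        simp
      refine ⟨⟨e.symm (b.1, 0), hm⟩, ?_⟩
      change Submodule.mkQ _ (p1 _) = _
      have : p1 ⟨e.symm (b.1, 0), hm⟩ = b := by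
        apply Subtype.ext
        rw [hp1]; simp
      rw [this]
    have E : Gr K wt d ≃ₗ[K] Gr K (wt' x wt) d :=
      (Submodule.quotEquivOfEq _ _ hker.symm).trans (q.quotKerEquivOfSurjective hsurj)
    refine ⟨Module.Finite.equiv E.symm, ?_⟩
    rw [E.finrank_eq, if_neg h, add_zero]

theorem Gr_base {X : Type} (wt : X → ℕ) (N : ℕ) (h : ∀ x, N + 1 ≤ wt x) (d : ℕ) (hd : d ≤ N) :
    Subsingleton (Gr K wt d) := by
  have h2 : W K wt (d + 1) = ⊤ := W_eq_top wt (d + 1) (fun x => by have := h x; omega)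
  rw [Submodule.Quotient.subsingleton_iff, h2, Submodule.comap_top]

/-- Number of letters of given weight. -/
noncomputable def cnt {X : Type} (wt : X → ℕ) (m : ℕ) : ℕ := Nat.card {y : X // wt y = m}

theorem fin_step {X : Type} (x : X) (wt : X → ℕ) (hpos : 0 < wt x)
    (hfin : ∀ m, Finite {y : X // wt y = m}) (m : ℕ) :
    Finite {p : Al x // wt' x wt p = m} := by
  let g : {p : Al x // wt' x wt p = m} → Fin (m + 1) × (Σ i : Fin (m + 1), {y : X // wt y = i}) :=
    fun p => (⟨p.1.1, by
        have := p.2; simp only [wt'] at this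
        have := Nat.le_mul_of_pos_right p.1.1 hpos
        omega⟩, ⟨⟨wt p.1.2.1, by
        have := p.2; simp only [wt'] at this
        omega⟩, ⟨p.1.2.1, rfl⟩⟩)
  have : ∀ i : Fin (m + 1), Finite {y : X // wt y = i} := fun i => hfin i
  refine Finite.of_injective g ?_
  rintro ⟨⟨i, y, hy⟩, hp⟩ ⟨⟨j, z, hz⟩, hq⟩ h
  simp only [g, Prod.mk.injEq, Fin.mk.injEq] at h
  obtain ⟨rfl, h⟩ := h
  have : y = z := by
    have := congrArg (fun s : (Σ i : Fin (m + 1), {y : X // wt y = i}) => s.2.1) h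
    exact this
  subst this
  rfl

theorem cnt_step {X : Type} (x : X) (wt : X → ℕ) (hpos : 0 < wt x)
    (hfin : ∀ m, Finite {y : X // wt y = m}) (m : ℕ) :
    cnt wt m + (if wt x ≤ m then cnt (wt' x wt) (m - wt x) else 0) =
      (if m = wt x then 1 else 0) + cnt (wt' x wt) m := by
  classical
  have hf := hfin m
  have hf' : Finite {y : {y : X // y ≠ x} // wt y.1 = m} :=
    Finite.of_injective (β := {y : X // wt y = m}) (fun y => ⟨y.1.1, y.2⟩) (by
      rintro ⟨⟨a, _⟩, _⟩ ⟨⟨b, _⟩, _⟩ h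
      simpa using h)
  have hA : cnt wt m = (if m = wt x then 1 else 0) +
      Nat.card {y : {y : X // y ≠ x} // wt y.1 = m} := by
    have E : {y : X // wt y = m} ≃ {u : Unit // m = wt x} ⊕ {y : {y : X // y ≠ x} // wt y.1 = m} :=
      { toFun := fun y => if h : y.1 = x then Sum.inl ⟨(), by rw [← h, y.2]⟩
          else Sum.inr ⟨⟨y.1, h⟩, y.2⟩
        invFun := Sum.elim (fun u => ⟨x, u.2.symm⟩) (fun y => ⟨y.1.1, y.2⟩)
        left_inv := by
          rintro ⟨y, hy⟩
          by_cases h : y = x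
          · subst h; simp
          · simp [h]
        right_inv := by
          rintro (⟨u, hu⟩ | ⟨⟨y, hy⟩, hy'⟩)
          · simp
          · simp [hy] }
    rw [cnt, Nat.card_congr E, Nat.card_sum]
    congr 1
    by_cases h : m = wt x <;> simp [h]
  have hB : cnt (wt' x wt) m = Nat.card {y : {y : X // y ≠ x} // wt y.1 = m} +
      (if wt x ≤ m then cnt (wt' x wt) (m - wt x) else 0) := by
    have E : {p : Al x // wt' x wt p = m} ≃ {y : {y : X // y ≠ x} // wt y.1 = m} ⊕
        {p : Al x // wt x + wt' x wt p = m} :=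
      { toFun := fun p => match p with
          | ⟨(0, y), h⟩ => Sum.inl ⟨y, by simpa [wt'] using h⟩
          | ⟨(i + 1, y), h⟩ => Sum.inr ⟨(i, y), by simp only [wt'] at h ⊢; rw [← h]; ring⟩
        invFun := Sum.elim (fun y => ⟨(0, y.1), by simpa [wt'] using y.2⟩)
          (fun p => ⟨(p.1.1 + 1, p.1.2), by
            have := p.2; simp only [wt'] at this ⊢; linarith⟩)
        left_inv := by
          rintro ⟨⟨i, y⟩, h⟩
          cases i <;> rfl
        right_inv := by
          rintro (⟨y, h⟩ | ⟨⟨i, y⟩, h⟩) <;> rfl }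
    have hf2 : Finite {p : Al x // wt x + wt' x wt p = m} := by
      have := fin_step x wt hpos hfin (m - wt x)
      exact Finite.of_injective (β := {p : Al x // wt' x wt p = m - wt x})
        (fun y => ⟨y.1, by have := y.2; omega⟩) (by
          rintro ⟨a, _⟩ ⟨b, _⟩ h
          simpa using h)
    rw [cnt, Nat.card_congr E, Nat.card_sum]
    congr 1
    by_cases h : wt x ≤ m
    · rw [if_pos h, cnt]
      refine Nat.card_congr (Equiv.subtypeEquivRight fun p => ?_)
      omega
    · rw [if_neg h]
      have : IsEmpty {p : Al x // wt x + wt' x wt p = m} := ⟨fun p => by have := p.2; omega⟩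
      simp
  rw [hA, hB]
  ring

theorem alph_induction (N : ℕ) (P : ∀ X : Type, (X → ℕ) → Prop)
    (base : ∀ X wt, (∀ x, N + 1 ≤ wt x) → P X wt)
    (step : ∀ X wt (x : X), 0 < wt x → (∀ m, Finite {y : X // wt y = m}) →
      P (Al x) (wt' x wt) → P X wt) :
    ∀ X wt, (∀ x, 0 < wt x) → (∀ m, Finite {y : X // wt y = m}) → P X wt := by
  have main : ∀ j : ℕ, ∀ (X : Type) (wt : X → ℕ), (∀ x, 0 < wt x) →
      (∀ m, Finite {y : X // wt y = m}) → (∀ x, N + 1 ≤ wt x + j) → P X wt := by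
    intro j
    induction j with
    | zero => intro X wt _ _ h; exact base X wt h
    | succ j ih =>
      have inner : ∀ c : ℕ, ∀ (X : Type) (wt : X → ℕ), (∀ x, 0 < wt x) →
          (∀ m, Finite {y : X // wt y = m}) → (∀ x, N + 1 ≤ wt x + (j + 1)) →
          cnt wt (N - j) = c → P X wt := by
        intro c
        induction c with
        | zero =>
          intro X wt hpos hfin hb hc
          refine ih X wt hpos hfin fun x => ?_
          have h1 := hb x
          have h2 := hpos x
          by_contra hlt
          have hf := hfin (N - j)
          rw [cnt, Finite.card_eq_zero_iff] at hc
          exact hc.false ⟨x, by omega⟩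
        | succ c ihc =>
          intro X wt hpos hfin hb hc
          have hne : Nonempty {y : X // wt y = N - j} := by
            by_contra hne
            rw [not_nonempty_iff] at hne
            simp [cnt] at hc
          obtain ⟨x, hx⟩ := hne
          have hpos' : ∀ p : Al x, 0 < wt' x wt p := fun p => by
            have := hpos p.2.1
            simp only [wt']; omega
          refine step X wt x (hpos x) hfin (ihc _ _ hpos' (fin_step x wt (hpos x) hfin) ?_ ?_)
          · intro p
            have := hb p.2.1
            simp only [wt']; omega
          · have := cnt_step x wt (hpos x) hfin (N - j)
            rw [if_pos hx.le, if_pos hx.symm, hc, hx, Nat.sub_self] at this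
            have h0 : cnt (wt' x wt) 0 = 0 := by
              have : IsEmpty {p : Al x // wt' x wt p = 0} :=
                ⟨fun p => by have := hpos' p.1; have := p.2; omega⟩
              simp [cnt]
            omega
      intro X wt hpos hfin hb
      exact inner _ X wt hpos hfin hb rfl
  intro X wt hpos hfin
  exact main (N + 1) X wt hpos hfin (fun x => by omega)

theorem Gr_finite {X : Type} (wt : X → ℕ) (hpos : ∀ x, 0 < wt x)
    (hfin : ∀ m, Finite {y : X // wt y = m}) (d : ℕ) : Module.Finite K (Gr K wt d) := by
  refine alph_induction d (fun X wt => Module.Finite K (Gr K wt d)) ?_ ?_ X wt hpos hfin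
  · intro X wt h
    have := Gr_base (K := K) wt d h d le_rfl
    infer_instance
  · intro X wt x _ _ h
    exact (Gr_step x wt d h).1

/-- `1 - g`. -/
noncomputable def serA {X : Type} (wt : X → ℕ) : PowerSeries ℚ :=
  1 - PowerSeries.mk (fun m => (cnt wt m : ℚ))

/-- `∑ (∑_{m ∣ d} m f(m)) t^d`. -/
noncomputable def serS (K : Type) [Field K] {X : Type} (wt : X → ℕ) : PowerSeries ℚ :=
  PowerSeries.mk (fun d => ∑ m ∈ d.divisors, (m : ℚ) * (Module.finrank K (Gr K wt m) : ℚ))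

/-- The expression which should vanish. -/
noncomputable def serE (K : Type) [Field K] {X : Type} (wt : X → ℕ) : PowerSeries ℚ :=
  serS K wt * serA wt + PowerSeries.X * PowerSeries.derivative ℚ (serA wt)

theorem serA_step {X : Type} (x : X) (wt : X → ℕ) (hpos : 0 < wt x)
    (hfin : ∀ m, Finite {y : X // wt y = m}) :
    serA wt = (1 - PowerSeries.X ^ (wt x)) * serA (wt' x wt) := by
  rw [serA, serA, sub_mul, one_mul, mul_sub, mul_one]
  ext m
  have h := cnt_step x wt hpos hfin m
  have h' := congrArg (Nat.cast : ℕ → ℚ) h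
  push_cast at h'
  simp only [map_sub, PowerSeries.coeff_mk, PowerSeries.coeff_X_pow_mul', PowerSeries.coeff_X_pow]
  linarith

theorem serS_step {X : Type} (x : X) (wt : X → ℕ) (hpos : 0 < wt x)
    (hfin : ∀ d, Module.Finite K (Gr K (wt' x wt) d)) :
    (1 - PowerSeries.X ^ (wt x)) * serS K wt =
      (1 - PowerSeries.X ^ (wt x)) * serS K (wt' x wt) +
        (wt x : PowerSeries ℚ) * PowerSeries.X ^ (wt x) := by
  set k := wt x with hk
  let T : PowerSeries ℚ := PowerSeries.mk (fun d => if k ∈ d.divisors then (k : ℚ) else 0)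
  have h1 : serS K wt = serS K (wt' x wt) + T := by
    ext d
    simp only [serS, T, map_add, PowerSeries.coeff_mk]
    have : ∀ m ∈ d.divisors, (m : ℚ) * (Module.finrank K (Gr K wt m) : ℚ) =
        (m : ℚ) * (Module.finrank K (Gr K (wt' x wt) m) : ℚ) + if k = m then (m : ℚ) else 0 := by
      intro m _
      rw [(Gr_step x wt m (hfin m)).2]
      by_cases h : m = k
      · rw [if_pos (h.trans hk), if_pos h.symm]; push_cast; ring
      · rw [if_neg (fun h' => h (h'.trans hk.symm)), if_neg (fun h' => h h'.symm)]; push_cast; ring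
    rw [Finset.sum_congr rfl this, Finset.sum_add_distrib, Finset.sum_ite_eq]
  have h2 : (1 - PowerSeries.X ^ k) * T = (k : PowerSeries ℚ) * PowerSeries.X ^ k := by
    ext d
    rw [sub_mul, one_mul]
    have : (k : PowerSeries ℚ) = PowerSeries.C (k : ℚ) := by simp
    rw [this, PowerSeries.coeff_C_mul, map_sub, PowerSeries.coeff_X_pow_mul',
      PowerSeries.coeff_X_pow]
    simp only [T, PowerSeries.coeff_mk, Nat.mem_divisors]
    by_cases hd : k ≤ d
    · obtain ⟨e, rfl⟩ := Nat.exists_eq_add_of_le hd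
      have h3 : k + e ≠ 0 := by omega
      rw [if_pos hd, Nat.add_sub_cancel_left]
      by_cases he : e = 0
      · subst he; simp [hpos.ne']
      · have h4 : k + e ≠ k := by omega
        simp [he]
    · have h5 : ¬ (k ∣ d ∧ d ≠ 0) := fun h => hd (Nat.le_of_dvd (Nat.pos_of_ne_zero h.2) h.1)
      have h6 : d ≠ k := by omega
      rw [if_neg hd, if_neg h5, if_neg h6]; simp
  rw [h1, mul_add, h2]

theorem serE_step {X : Type} (x : X) (wt : X → ℕ) (hpos : 0 < wt x)
    (hfin : ∀ m, Finite {y : X // wt y = m})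
    (hfin' : ∀ d, Module.Finite K (Gr K (wt' x wt) d)) :
    serE K wt = (1 - PowerSeries.X ^ (wt x)) * serE K (wt' x wt) := by
  have hS := serS_step x wt hpos hfin'
  rw [serE, serE, serA_step x wt hpos hfin]
  obtain ⟨k, hk⟩ : ∃ k, wt x = k + 1 := ⟨wt x - 1, by omega⟩
  rw [hk] at hS ⊢
  have hder : PowerSeries.derivative ℚ ((1 - PowerSeries.X ^ (k + 1)) * serA (wt' x wt)) =
      (1 - PowerSeries.X ^ (k + 1)) * PowerSeries.derivative ℚ (serA (wt' x wt)) -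
      ((k + 1 : ℕ) : PowerSeries ℚ) * PowerSeries.X ^ k * serA (wt' x wt) := by
    rw [Derivation.leibniz, map_sub, Derivation.leibniz_pow]
    simp only [smul_eq_mul, nsmul_eq_mul, PowerSeries.derivative_X, Derivation.map_one_eq_zero]
    simp
    ring
  rw [hder]
  linear_combination serA (wt' x wt) * hS

theorem serE_coeff (N : ℕ) {X : Type} (wt : X → ℕ) (hpos : ∀ x, 0 < wt x)
    (hfin : ∀ m, Finite {y : X // wt y = m}) :
    ∀ d ≤ N, PowerSeries.coeff d (serE K wt) = 0 := by
  refine (alph_induction N (fun X wt => (∀ x, 0 < wt x) →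
    ∀ d ≤ N, PowerSeries.coeff d (serE K wt) = 0) ?_ ?_ X wt hpos hfin) hpos
  · intro X wt h _ d hd
    have hS : ∀ i ≤ N, PowerSeries.coeff i (serS K wt) = 0 := by
      intro i hi
      rw [serS, PowerSeries.coeff_mk]
      refine Finset.sum_eq_zero fun m hm => ?_
      have := Nat.divisor_le hm
      have := Gr_base (K := K) wt N h m (by omega)
      rw [Module.finrank_zero_of_subsingleton]; simp
    rw [serE, map_add, PowerSeries.coeff_mul]
    rw [Finset.sum_eq_zero, zero_add]
    · cases d with
      | zero => simp
      | succ e =>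
        rw [PowerSeries.coeff_succ_X_mul, PowerSeries.coeff_derivative, serA, map_sub,
          PowerSeries.coeff_mk]
        have : IsEmpty {y : X // wt y = e + 1} := ⟨fun y => by have := h y.1; have := y.2; omega⟩
        simp [cnt, PowerSeries.coeff_one]
    · intro p hp
      replace hp := Finset.HasAntidiagonal.mem_antidiagonal.1 hp
      rw [hS p.1 (by omega), zero_mul]
  · intro X wt x hx hf ih hpos d hd
    have hpos' : ∀ p : Al x, 0 < wt' x wt p := fun p => by
      have := hpos p.2.1
      simp only [wt']; omega
    rw [serE_step x wt hx hf (Gr_finite _ hpos' (fin_step x wt hx hf)), sub_mul, one_mul, map_sub,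
      PowerSeries.coeff_X_pow_mul', ih hpos' d hd]
    split_ifs
    · rw [ih hpos' _ (by omega), sub_zero]
    · simp

/-- The sum formula for standard weights. -/
theorem sum_formula (K : Type) [Field K] (n d : ℕ) (hd : 0 < d) :
    ∑ m ∈ d.divisors, (m : ℚ) * (Module.finrank K (Gr K (fun _ : Fin n => 1) m) : ℚ) =
      (n : ℚ) ^ d := by
  have hE : serE K (fun _ : Fin n => 1) = 0 := by
    ext d
    simpa using serE_coeff (K := K) d (fun _ : Fin n => 1) (fun _ => one_pos)
      (fun m => inferInstance) d le_rfl
  have hA : serA (fun _ : Fin n => 1) = 1 - PowerSeries.C (n : ℚ) * PowerSeries.X := by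
    rw [serA]
    congr 1
    ext m
    rw [PowerSeries.coeff_mk, PowerSeries.coeff_C_mul, PowerSeries.coeff_X, cnt]
    by_cases h : m = 1
    · subst h; simp
    · have : IsEmpty {y : Fin n // 1 = m} := ⟨fun y => h y.2.symm⟩
      rw [if_neg h]; simp
  have key : ∀ e, PowerSeries.coeff (e + 1) (serS K (fun _ : Fin n => 1)) =
      n * PowerSeries.coeff e (serS K (fun _ : Fin n => 1)) + if e = 0 then (n : ℚ) else 0 := by
    intro e
    have h := congrArg (PowerSeries.coeff (e + 1)) hE
    rw [serE, hA, mul_sub, mul_one, mul_left_comm, map_add, map_sub, PowerSeries.coeff_C_mul,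
      PowerSeries.coeff_succ_mul_X, PowerSeries.coeff_succ_X_mul, PowerSeries.coeff_derivative,
      map_sub, PowerSeries.coeff_C_mul, PowerSeries.coeff_X, PowerSeries.coeff_one, map_zero] at h
    by_cases he : e = 0
    · subst he; simp at h ⊢; linarith
    · simp [he] at h ⊢; linarith
  have h0 : PowerSeries.coeff 0 (serS K (fun _ : Fin n => 1)) = 0 := by
    rw [serS, PowerSeries.coeff_mk]; simp
  have fin : ∀ e, PowerSeries.coeff (e + 1) (serS K (fun _ : Fin n => 1)) = (n : ℚ) ^ (e + 1) := by
    intro e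
    induction e with
    | zero => rw [key, h0]; simp
    | succ e ih => rw [key, ih]; simp; ring
  obtain ⟨e, rfl⟩ : ∃ e, d = e + 1 := ⟨d - 1, by omega⟩
  have := fin e
  rwa [serS, PowerSeries.coeff_mk] at this

/-! ### Lower central series -/

theorem lie_lcs {L : Type} [LieRing L] [LieAlgebra K L] (i : ℕ) : ∀ (j : ℕ) (a b : L),
    a ∈ lowerCentralSeries K L L i → b ∈ lowerCentralSeries K L L j →
    ⁅a, b⁆ ∈ lowerCentralSeries K L L (i + j + 1) := by
  induction i with
  | zero =>
    intro j a b _ hb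
    rw [lowerCentralSeries_succ, zero_add]
    exact LieSubmodule.lie_mem_lie (LieSubmodule.mem_top a) hb
  | succ i ih =>
    intro j a b ha hb
    rw [lowerCentralSeries_succ, ← LieSubmodule.mem_toSubmodule,
      LieSubmodule.lieIdeal_oper_eq_linear_span'] at ha
    induction ha using Submodule.span_induction with
    | zero => simp
    | add x y _ _ hx hy => rw [add_lie]; exact add_mem hx hy
    | smul t x _ hx => rw [smul_lie]; exact SMulMemClass.smul_mem _ hx
    | mem a ha =>
      obtain ⟨x, _, y, hy, rfl⟩ := ha
      rw [lie_lie]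
      refine sub_mem ?_ ?_
      · rw [lowerCentralSeries_succ]
        have := ih j y b hy hb
        refine LieSubmodule.lie_mem_lie (LieSubmodule.mem_top x) ?_
        convert this using 2; ring
      · have h1 : ⁅x, b⁆ ∈ lowerCentralSeries K L L (j + 1) := by
          rw [lowerCentralSeries_succ]
          exact LieSubmodule.lie_mem_lie (LieSubmodule.mem_top x) hb
        have := ih (j + 1) y _ hy h1
        convert this using 2; ring

theorem lcs_eq_W (n d : ℕ) :
    (lowerCentralSeries K (FreeLieAlgebra K (Fin n)) (FreeLieAlgebra K (Fin n)) d).toSubmodule =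
      W K (fun _ : Fin n => 1) (d + 1) := by
  apply le_antisymm
  · induction d with
    | zero => rw [zero_add, W_eq_top _ 1 (fun _ => le_rfl)]; exact le_top
    | succ d ih =>
      rw [lowerCentralSeries_succ, LieSubmodule.lieIdeal_oper_eq_linear_span', Submodule.span_le]
      rintro _ ⟨x, _, y, hy, rfl⟩
      have hx : x ∈ W K (fun _ : Fin n => 1) 1 := by
        rw [W_eq_top _ 1 (fun _ => le_rfl)]; trivial
      have := lie_mem_W _ hx (ih hy)
      rw [SetLike.mem_coe]
      convert this using 2; ring
  · intro a ha
    have := W_map (K := K) (fun _ : Fin n => 1) (LieHom.id)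
      (fun k => (lowerCentralSeries K (FreeLieAlgebra K (Fin n)) (FreeLieAlgebra K (Fin n))
        (k - 1)).toSubmodule) ?_ ?_ ?_ ha
    · simpa using this
    · intro i j h
      exact antitone_lowerCentralSeries K _ _ (Nat.sub_le_sub_right h 1)
    · intro x
      simp
    · intro i j a b ha hb
      exact antitone_lowerCentralSeries K _ _ (by omega) (lie_lcs _ _ a b ha hb)

end WittDim

theorem stmt0 (K : Type) [Field K] [CharZero K] (n d : ℕ) (hd : 1 ≤ d) :
    (Module.finrank K (lieIdealQuot K
        (lowerCentralSeries K (FreeLieAlgebra K (Fin n)) (FreeLieAlgebra K (Fin n)) (d - 1))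
        (lowerCentralSeries K (FreeLieAlgebra K (Fin n)) (FreeLieAlgebra K (Fin n)) d)) : ℚ)
      = lWitt n d := by
  have h1 : Module.finrank K (lieIdealQuot K
        (lowerCentralSeries K (FreeLieAlgebra K (Fin n)) (FreeLieAlgebra K (Fin n)) (d - 1))
        (lowerCentralSeries K (FreeLieAlgebra K (Fin n)) (FreeLieAlgebra K (Fin n)) d)) =
      Module.finrank K (WittDim.Gr K (fun _ : Fin n => 1) d) := by
    unfold lieIdealQuot WittDim.Gr
    rw [WittDim.lcs_eq_W n d, WittDim.lcs_eq_W n (d - 1), Nat.sub_add_cancel hd]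
  rw [h1]
  have h2 := (ArithmeticFunction.sum_eq_iff_sum_mul_moebius_eq (R := ℚ)
    (f := fun m => (m : ℚ) * (Module.finrank K (WittDim.Gr K (fun _ : Fin n => 1) m) : ℚ))
    (g := fun d => (n : ℚ) ^ d)).1 (fun d hd => WittDim.sum_formula K n d hd) d hd
  rw [Nat.sum_divisorsAntidiagonal (f := fun a b =>
    ((ArithmeticFunction.moebius a : ℤ) : ℚ) * (n : ℚ) ^ b)] at h2
  rw [lWitt, h2]
  have : (d : ℚ) ≠ 0 := by positivity
  field_simp
end

section
/- Let L be a nilpotent Lie algebra of class c which is generated by n elements. Then dim M(L) ≤ sum over j = 1 to c of l_n(j+1), where l_n(q) = (1/q) * sum over divisors s of q of mu(s) * n^(q/s). -/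
open LieModule Finset

theorem lcs_lie_mem {K Q : Type*} [Field K] [LieRing Q] [LieAlgebra K Q] (i : ℕ) :
    ∀ (j : ℕ) (x y : Q), x ∈ lowerCentralSeries K Q Q i → y ∈ lowerCentralSeries K Q Q j →
      ⁅x, y⁆ ∈ lowerCentralSeries K Q Q (i + j + 1) := by
  induction i with
  | zero =>
    intro j x y _ hy
    rw [show 0 + j + 1 = j + 1 by omega, lowerCentralSeries_succ]
    exact LieSubmodule.lie_mem_lie (LieSubmodule.mem_top x) hy
  | succ i ih =>
    intro j x y hx hy
    rw [lowerCentralSeries_succ, ← LieSubmodule.mem_toSubmodule,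
      LieSubmodule.lieIdeal_oper_eq_linear_span'] at hx
    induction hx using Submodule.span_induction with
    | mem z hz =>
      obtain ⟨a, -, b, hb, rfl⟩ := hz
      rw [lie_lie]
      have h1 : ⁅a, ⁅b, y⁆⁆ ∈ lowerCentralSeries K Q Q (i + 1 + j + 1) := by
        rw [show i + 1 + j + 1 = (i + j + 1) + 1 by omega, lowerCentralSeries_succ]
        exact LieSubmodule.lie_mem_lie (LieSubmodule.mem_top a) (ih j b y hb hy)
      have h2 : ⁅b, ⁅a, y⁆⁆ ∈ lowerCentralSeries K Q Q (i + 1 + j + 1) := by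
        rw [show i + 1 + j + 1 = i + (j + 1) + 1 by omega]
        refine ih (j + 1) b _ hb ?_
        rw [lowerCentralSeries_succ]
        exact LieSubmodule.lie_mem_lie (LieSubmodule.mem_top a) hy
      exact sub_mem h1 h2
    | zero => simp
    | add u v _ _ hu hv => rw [add_lie]; exact add_mem hu hv
    | smul t u _ hu => rw [smul_lie]; exact Submodule.smul_mem (lowerCentralSeries K Q Q (i + 1 + j + 1)).toSubmodule _ hu

theorem ad_pow_mem {K Q : Type*} [Field K] [LieRing Q] [LieAlgebra K Q] {d e : ℕ}
    (hd : 1 ≤ d) (he : 1 ≤ e) {x y : Q} (hx : x ∈ lowerCentralSeries K Q Q (d - 1))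
    (hy : y ∈ lowerCentralSeries K Q Q (e - 1)) (k : ℕ) :
    ((LieAlgebra.ad K Q x) ^ k) y ∈ lowerCentralSeries K Q Q (e + k * d - 1) := by
  induction k with
  | zero => simpa using hy
  | succ k ih =>
    rw [pow_succ', Module.End.mul_apply, LieAlgebra.ad_apply]
    have := lcs_lie_mem _ _ _ _ hx ih
    convert this using 2
    rw [add_mul]
    omega

/-- Elimination of one generator `x`. -/
theorem elim_step {K Q : Type*} [Field K] [LieRing Q] [LieAlgebra K Q] (x : Q) (Y Z : Set Q)
    (hYZ : Y ⊆ Z) (hZ : ∀ z ∈ Z, ⁅x, z⁆ ∈ LieSubalgebra.lieSpan K Q Z) (W : Set Q)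
    (hW : W ⊆ insert x Y) :
    (LieSubalgebra.lieSpan K Q W).toSubmodule ≤
      Submodule.span K {x} ⊔ (LieSubalgebra.lieSpan K Q Z).toSubmodule := by
  set B := LieSubalgebra.lieSpan K Q Z with hB
  have hstab : ∀ b ∈ B, ⁅x, b⁆ ∈ B := by
    intro b hb
    induction hb using LieSubalgebra.lieSpan_induction with
    | mem u hu => exact hZ u hu
    | zero => simp
    | add u v _ _ hu hv => rw [lie_add]; exact add_mem hu hv
    | smul t u _ hu => rw [lie_smul]; exact B.smul_mem _ hu
    | lie u v hu' hv' hu hv =>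
      rw [leibniz_lie]
      exact add_mem (B.lie_mem hu hv') (B.lie_mem hu' hv)
  let A : LieSubalgebra K Q :=
    { (Submodule.span K {x} ⊔ B.toSubmodule) with
      lie_mem' := by
        intro u v hu hv
        change u ∈ Submodule.span K {x} ⊔ B.toSubmodule at hu
        change v ∈ Submodule.span K {x} ⊔ B.toSubmodule at hv
        change ⁅u, v⁆ ∈ Submodule.span K {x} ⊔ B.toSubmodule
        obtain ⟨u1, hu1, u2, hu2, rfl⟩ := Submodule.mem_sup.1 hu
        obtain ⟨v1, hv1, v2, hv2, rfl⟩ := Submodule.mem_sup.1 hv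
        obtain ⟨a, rfl⟩ := Submodule.mem_span_singleton.1 hu1
        obtain ⟨b, rfl⟩ := Submodule.mem_span_singleton.1 hv1
        apply Submodule.mem_sup_right
        have e : ⁅a • x + u2, b • x + v2⁆ = a • ⁅x, v2⁆ - b • ⁅x, u2⁆ + ⁅u2, v2⁆ := by
          simp only [add_lie, lie_add, smul_lie, lie_smul, lie_self, smul_zero]
          rw [← lie_skew u2 x, zero_add, smul_neg]
          abel
        rw [e]
        exact add_mem (sub_mem (B.smul_mem _ (hstab _ hv2)) (B.smul_mem _ (hstab _ hu2)))
          (B.lie_mem hu2 hv2) }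
  have : LieSubalgebra.lieSpan K Q W ≤ A := by
    rw [LieSubalgebra.lieSpan_le]
    intro w hw
    change w ∈ Submodule.span K {x} ⊔ B.toSubmodule
    rcases hW hw with rfl | h
    · exact Submodule.mem_sup_left (Submodule.mem_span_singleton_self _)
    · exact Submodule.mem_sup_right (LieSubalgebra.subset_lieSpan (hYZ h))
  exact this

/-- `1 - ∑ X^{deg}`. -/
noncomputable def genf {Q : Type*} (S : List (Q × ℕ)) : PowerSeries ℚ :=
  1 - (S.map (fun p => (PowerSeries.X : PowerSeries ℚ) ^ p.2)).sum

theorem genf_flat {Q : Type*} (T : List (Q × ℕ)) (N d : ℕ) (f : ℕ → Q → Q) :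
    ((T.flatMap (fun p => (List.range N).map
      (fun k => (f k p.1, p.2 + (k + 1) * d)))).map
      (fun p => (PowerSeries.X : PowerSeries ℚ) ^ p.2)).sum =
    (T.map (fun p => (PowerSeries.X : PowerSeries ℚ) ^ p.2)).sum *
      ∑ k ∈ Finset.range N, ((PowerSeries.X : PowerSeries ℚ) ^ d) ^ (k + 1) := by
  induction T with
  | nil => simp
  | cons p T ih =>
    simp only [List.flatMap_cons, List.map_append, List.sum_append, List.map_cons,
      List.sum_cons, List.map_map]
    rw [ih, add_mul (_ ^ p.2)]
    congr 1
    rw [Finset.mul_sum, Finset.sum_range]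
    rw [← List.sum_ofFn, List.ofFn_eq_map, ← List.map_coe_finRange_eq_range, List.map_map]
    congr 1
    apply List.map_congr_left
    intro i _
    simp [pow_add, pow_mul, mul_comm]

theorem main_elim {K Q : Type*} [Field K] [LieRing Q] [LieAlgebra K Q] (N : ℕ)
    (hN : lowerCentralSeries K Q Q N = ⊥) :
    ∀ k d : ℕ, d + k = N + 1 → 1 ≤ d → ∀ (m : ℕ) (S : List (Q × ℕ)),
      (∀ p ∈ S, d ≤ p.2 ∧ p.1 ∈ lowerCentralSeries K Q Q (p.2 - 1)) →
      S.countP (fun p => p.2 = d) = m →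
      ∃ D : List ℕ, (∀ e ∈ D, 1 ≤ e ∧ e ≤ N) ∧
        (PowerSeries.X : PowerSeries ℚ) ^ (N + 1) ∣
          genf S - (D.map (fun e => 1 - (PowerSeries.X : PowerSeries ℚ) ^ e)).prod ∧
        ∃ s : List Q, s.length ≤ D.length ∧
          (LieSubalgebra.lieSpan K Q {x | ∃ p ∈ S, p.1 = x}).toSubmodule ≤
            Submodule.span K {x | x ∈ s} := by
  intro k
  induction k with
  | zero =>
    intro d hd _ m S hS _
    refine ⟨[], by simp, ?_, [], by simp, ?_⟩
    · simp only [genf, List.map_nil, List.prod_nil]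
      rw [sub_sub_cancel_left, dvd_neg]
      apply List.dvd_sum
      intro a ha
      obtain ⟨p, hp, rfl⟩ := List.mem_map.1 ha
      have := (hS p hp).1
      exact pow_dvd_pow _ (by omega)
    · have : LieSubalgebra.lieSpan K Q {x | ∃ p ∈ S, p.1 = x} ≤ ⊥ := by
        rw [LieSubalgebra.lieSpan_le]
        rintro x ⟨p, hp, rfl⟩
        obtain ⟨h1, h2⟩ := hS p hp
        have := antitone_lowerCentralSeries K Q Q (show N ≤ p.2 - 1 by omega) h2
        rw [hN] at this
        simpa using this
      intro x hx
      have hx' := this hx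
      rw [LieSubalgebra.mem_bot] at hx'
      rw [hx']
      exact zero_mem _
  | succ k ihk =>
    intro d hd hd1 m
    induction m with
    | zero =>
      intro S hS hc
      refine ihk (d + 1) (by omega) (by omega) _ S ?_ rfl
      intro p hp
      refine ⟨?_, (hS p hp).2⟩
      have := List.countP_eq_zero.1 hc p hp
      have := (hS p hp).1
      simp at *
      omega
    | succ m ihm =>
      intro S hS hc
      obtain ⟨p, hp, hpd⟩ := List.countP_pos_iff.1 (show 0 < S.countP (fun p => p.2 = d) by omega)
      have hpd : p.2 = d := by simpa using hpd
      obtain ⟨S1, S2, rfl⟩ := List.append_of_mem hp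
      obtain ⟨x, d'⟩ := p
      simp only at hpd
      subst hpd
      set T := S1 ++ S2 with hT
      have hx := (hS _ hp).2
      have hTS : ∀ q ∈ T, q ∈ S1 ++ (x, d') :: S2 := by
        intro q hq; rw [hT] at hq; simp at hq ⊢; tauto
      have hTc : T.countP (fun p => p.2 = d') = m := by
        rw [hT]; simp at hc ⊢; omega
      have hTg : genf (S1 ++ (x, d') :: S2) = 1 - (PowerSeries.X : PowerSeries ℚ) ^ d' -
          (T.map (fun p => (PowerSeries.X : PowerSeries ℚ) ^ p.2)).sum := by
        simp [genf, hT]; ring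
      set U := T.flatMap (fun p => (List.range N).map
        (fun k => (((LieAlgebra.ad K Q x) ^ (k + 1)) p.1, p.2 + (k + 1) * d'))) with hU
      have hUmem : ∀ q ∈ U, ∃ p ∈ T, ∃ k < N,
          q = (((LieAlgebra.ad K Q x) ^ (k + 1)) p.1, p.2 + (k + 1) * d') := by
        intro q hq
        rw [hU, List.mem_flatMap] at hq
        obtain ⟨p, hp, hq⟩ := hq
        obtain ⟨k, hk, rfl⟩ := List.mem_map.1 hq
        exact ⟨p, hp, k, List.mem_range.1 hk, rfl⟩
      obtain ⟨D, hD, hdvd, s, hs, hspan⟩ := ihm (T ++ U) (by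
        intro q hq
        rcases List.mem_append.1 hq with hq | hq
        · exact hS q (hTS q hq)
        · obtain ⟨p, hp, k, hk, rfl⟩ := hUmem q hq
          obtain ⟨h1, h2⟩ := hS p (hTS p hp)
          refine ⟨by simp only; omega, ad_pow_mem hd1 (by omega) hx h2 (k + 1)⟩) (by
        rw [List.countP_append, hTc, Nat.add_eq_left, List.countP_eq_zero]
        intro q hq
        obtain ⟨p, hp, k, hk, rfl⟩ := hUmem q hq
        obtain ⟨h1, h2⟩ := hS p (hTS p hp)
        simp only [decide_eq_true_eq]
        have : 0 < (k + 1) * d' := by positivity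
        omega)
      refine ⟨d' :: D, ?_, ?_, x :: s, by simpa using hs, ?_⟩
      · intro e he
        rcases List.mem_cons.1 he with rfl | he
        · omega
        · exact hD e he
      · have hg : genf (T ++ U) = 1 - (T.map (fun p => (PowerSeries.X : PowerSeries ℚ) ^ p.2)).sum *
            ∑ k ∈ Finset.range (N + 1), ((PowerSeries.X : PowerSeries ℚ) ^ d') ^ k := by
          rw [genf, List.map_append, List.sum_append, hU,
            genf_flat T N d' (fun k => ((LieAlgebra.ad K Q x) ^ (k + 1) : Module.End K Q)),
            Finset.sum_range_succ']
          ring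
        have hgeom := mul_neg_geom_sum ((PowerSeries.X : PowerSeries ℚ) ^ d') (N + 1)
        rw [List.map_cons, List.prod_cons]
        set τ := (T.map (fun p => (PowerSeries.X : PowerSeries ℚ) ^ p.2)).sum
        set P := (D.map (fun e => 1 - (PowerSeries.X : PowerSeries ℚ) ^ e)).prod
        set g := ∑ k ∈ Finset.range (N + 1), ((PowerSeries.X : PowerSeries ℚ) ^ d') ^ k
        have e : genf (S1 ++ (x, d') :: S2) - (1 - PowerSeries.X ^ d') * P =
            (1 - PowerSeries.X ^ d') * (genf (T ++ U) - P) -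
              τ * (PowerSeries.X ^ d') ^ (N + 1) := by
          rw [hTg, hg]
          linear_combination τ * hgeom
        rw [e]
        refine dvd_sub (Dvd.dvd.mul_left hdvd _) (Dvd.dvd.mul_left ?_ _)
        rw [← pow_mul]
        exact pow_dvd_pow _ (by nlinarith)
      · refine (elim_step x {y | ∃ p ∈ T, p.1 = y} {y | ∃ p ∈ T ++ U, p.1 = y} ?_ ?_ _ ?_).trans ?_
        · rintro y ⟨p, hp, rfl⟩
          exact ⟨p, List.mem_append_left _ hp, rfl⟩
        · have key : ∀ p ∈ T, ∀ k, k < N + 1 → ⁅x, ((LieAlgebra.ad K Q x) ^ k) p.1⁆ ∈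
              LieSubalgebra.lieSpan K Q {y | ∃ p ∈ T ++ U, p.1 = y} := by
            intro p hp k hk
            rw [← LieAlgebra.ad_apply K, ← Module.End.mul_apply, ← pow_succ']
            by_cases hkN : k < N
            · apply LieSubalgebra.subset_lieSpan
              refine ⟨(((LieAlgebra.ad K Q x) ^ (k + 1)) p.1, p.2 + (k + 1) * d'), ?_, rfl⟩
              apply List.mem_append_right
              rw [hU, List.mem_flatMap]
              exact ⟨p, hp, List.mem_map.2 ⟨k, List.mem_range.2 hkN, rfl⟩⟩
            · obtain ⟨h1, h2⟩ := hS p (hTS p hp)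
              have h3 := ad_pow_mem hd1 (by omega) hx h2 (k + 1)
              have h4 : k + 1 ≤ (k + 1) * d' := Nat.le_mul_of_pos_right _ hd1
              have := antitone_lowerCentralSeries K Q Q
                (show N ≤ p.2 + (k + 1) * d' - 1 by omega) h3
              rw [hN, LieSubmodule.mem_bot] at this
              rw [this]
              exact zero_mem _
          rintro z ⟨q, hq, rfl⟩
          rcases List.mem_append.1 hq with hq | hq
          · simpa using key q hq 0 (by omega)
          · obtain ⟨p, hp, k, hk, rfl⟩ := hUmem q hq
            exact key p hp (k + 1) (by omega)
        · rintro y ⟨p, hp, rfl⟩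
          simp only [List.mem_append, List.mem_cons] at hp
          rcases hp with hp | rfl | hp
          · exact Or.inr ⟨p, by simp [hT, hp], rfl⟩
          · exact Or.inl rfl
          · exact Or.inr ⟨p, by simp [hT, hp], rfl⟩
        · refine sup_le ?_ (hspan.trans ?_)
          · apply Submodule.span_mono
            rintro y rfl
            simp
          · apply Submodule.span_mono
            intro y hy
            simp at hy ⊢
            exact Or.inr hy

/-- The series `∑_{m ≥ 1} X^{d m}`. -/
noncomputable def geoG (d : ℕ) : PowerSeries ℚ :=
  PowerSeries.mk (fun m => if m ≠ 0 ∧ d ∣ m then (1 : ℚ) else 0)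

theorem geoG_mul (d : ℕ) (hd : 1 ≤ d) :
    (1 - (PowerSeries.X : PowerSeries ℚ) ^ d) * geoG d = PowerSeries.X ^ d := by
  ext m
  rw [sub_mul, one_mul, map_sub, PowerSeries.coeff_X_pow_mul', PowerSeries.coeff_X_pow]
  simp only [geoG, PowerSeries.coeff_mk]
  by_cases h : d ≤ m
  · obtain ⟨r, rfl⟩ := Nat.exists_eq_add_of_le h
    by_cases hr : r = 0
    · subst hr
      have : d ≠ 0 := by omega
      simp [this]
    · have : d ≠ 0 := by omega
      simp [this, hr]
  · by_cases hm : m = 0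
    · subst hm; simp; omega
    · have : ¬ d ∣ m := fun h' => h (Nat.le_of_dvd (by omega) h')
      have h3 : m ≠ d := by omega
      simp [this, h, h3]

theorem logderiv (D : List ℕ) (hD : ∀ e ∈ D, 1 ≤ e) :
    PowerSeries.X * PowerSeries.derivative ℚ
      (D.map (fun e => 1 - (PowerSeries.X : PowerSeries ℚ) ^ e)).prod =
    -((D.map (fun e => 1 - (PowerSeries.X : PowerSeries ℚ) ^ e)).prod *
      (D.map (fun e : ℕ => (e : PowerSeries ℚ) * geoG e)).sum) := by
  induction D with
  | nil => simp
  | cons e D ih =>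
    have ih := ih (fun a ha => hD a (List.mem_cons_of_mem _ ha))
    have he := hD e List.mem_cons_self
    simp only [List.map_cons, List.prod_cons, List.sum_cons]
    set P := (D.map (fun e => 1 - (PowerSeries.X : PowerSeries ℚ) ^ e)).prod
    set H := (D.map (fun e : ℕ => (e : PowerSeries ℚ) * geoG e)).sum
    have h1 : PowerSeries.X * PowerSeries.derivative ℚ (1 - (PowerSeries.X : PowerSeries ℚ) ^ e) =
        - ((e : PowerSeries ℚ) * PowerSeries.X ^ e) := by
      obtain ⟨r, rfl⟩ := Nat.exists_eq_add_of_le he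
      rw [map_sub, PowerSeries.derivative_one, PowerSeries.derivative_pow,
        PowerSeries.derivative_X]
      simp [pow_add]
      ring
    have h2 := geoG_mul e he
    rw [Derivation.leibniz, smul_eq_mul, smul_eq_mul]
    linear_combination (1 - (PowerSeries.X : PowerSeries ℚ) ^ e) * ih + P * h1 + (e : PowerSeries ℚ) * P * h2

theorem coeff_H (D : List ℕ) (q : ℕ) (hq : 1 ≤ q) :
    PowerSeries.coeff q (D.map (fun e : ℕ => (e : PowerSeries ℚ) * geoG e)).sum =
      ∑ e ∈ q.divisors, (e : ℚ) * (D.count e : ℚ) := by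
  induction D with
  | nil => simp
  | cons a D ih =>
    rw [List.map_cons, List.sum_cons, map_add, ih]
    have h : PowerSeries.coeff q ((a : PowerSeries ℚ) * geoG a) =
        ∑ e ∈ q.divisors, if a = e then (e : ℚ) else 0 := by
      rw [Finset.sum_ite_eq, show (a : PowerSeries ℚ) = PowerSeries.C (a : ℚ) by simp,
        PowerSeries.coeff_C_mul]
      have : q ≠ 0 := by omega
      simp [geoG, this]
    rw [h, ← Finset.sum_add_distrib]
    apply Finset.sum_congr rfl
    intro e _
    rw [List.count_cons]
    by_cases hae : a = e
    · simp [hae]; ring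
    · simp [hae]

theorem coeff_H_zero (D : List ℕ) :
    PowerSeries.coeff 0 (D.map (fun e : ℕ => (e : PowerSeries ℚ) * geoG e)).sum = 0 := by
  induction D with
  | nil => simp
  | cons a D ih =>
    rw [List.map_cons, List.sum_cons, map_add, ih, 
      show (a : PowerSeries ℚ) = PowerSeries.C (a : ℚ) by simp, PowerSeries.coeff_C_mul]
    simp [geoG]

theorem witt_pow (n N : ℕ) (D : List ℕ) (hD : ∀ e ∈ D, 1 ≤ e ∧ e ≤ N)
    (h : (PowerSeries.X : PowerSeries ℚ) ^ (N + 1) ∣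
      (1 - PowerSeries.C (n : ℚ) * PowerSeries.X) -
        (D.map (fun e => 1 - (PowerSeries.X : PowerSeries ℚ) ^ e)).prod)
    (q : ℕ) (hq : 1 ≤ q) (hqN : q ≤ N) :
    ∑ e ∈ q.divisors, (e : ℚ) * (D.count e : ℚ) = (n : ℚ) ^ q := by
  rw [← coeff_H D q hq]
  have hl := logderiv D (fun e he => (hD e he).1)
  set P := (D.map (fun e => 1 - (PowerSeries.X : PowerSeries ℚ) ^ e)).prod
  have h0 := coeff_H_zero D
  set H := (D.map (fun e : ℕ => (e : PowerSeries ℚ) * geoG e)).sum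
  obtain ⟨R, hR⟩ := h
  have hP : P = 1 - PowerSeries.C (n : ℚ) * PowerSeries.X - PowerSeries.X ^ (N + 1) * R := by
    rw [← hR]; ring
  rw [hP] at hl
  have hd : PowerSeries.X * PowerSeries.derivative ℚ
      (1 - PowerSeries.C (n : ℚ) * PowerSeries.X - PowerSeries.X ^ (N + 1) * R) =
      - (PowerSeries.C (n : ℚ) * PowerSeries.X) - PowerSeries.X ^ (N + 1) *
        (((N + 1 : ℕ) : PowerSeries ℚ) * R + PowerSeries.X * PowerSeries.derivative ℚ R) := by
    rw [map_sub, map_sub, Derivation.leibniz, Derivation.leibniz, PowerSeries.derivative_one,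
      PowerSeries.derivative_pow, PowerSeries.derivative_X, PowerSeries.derivative_C]
    simp only [smul_eq_mul, Nat.add_sub_cancel]
    ring
  rw [hd] at hl
  have hE : H - PowerSeries.C (n : ℚ) * (PowerSeries.X * H) = PowerSeries.C (n : ℚ) * PowerSeries.X
      + PowerSeries.X ^ (N + 1) * (((N + 1 : ℕ) : PowerSeries ℚ) * R +
        PowerSeries.X * PowerSeries.derivative ℚ R + R * H) := by
    linear_combination hl
  have hrec : ∀ m, m < N → PowerSeries.coeff (m + 1) H =
      n * PowerSeries.coeff m H + if m = 0 then (n : ℚ) else 0 := by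
    intro m hm
    have := congrArg (PowerSeries.coeff (m + 1)) hE
    rw [map_sub, map_add, PowerSeries.coeff_C_mul, PowerSeries.coeff_C_mul,
      PowerSeries.coeff_succ_X_mul, PowerSeries.coeff_X_pow_mul', PowerSeries.coeff_X,
      if_neg (show ¬ N + 1 ≤ m + 1 by omega)] at this
    simp at this
    rw [← this]; ring
  clear_value H
  obtain ⟨m, rfl⟩ := Nat.exists_eq_add_of_le' hq
  clear hq
  induction m with
  | zero => rw [hrec 0 (by omega), h0]; simp
  | succ m ih => rw [hrec (m + 1) (by omega), ih (by omega)]; simp; ring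

theorem witt_count (n N : ℕ) (D : List ℕ) (hD : ∀ e ∈ D, 1 ≤ e ∧ e ≤ N)
    (h : (PowerSeries.X : PowerSeries ℚ) ^ (N + 1) ∣
      (1 - PowerSeries.C (n : ℚ) * PowerSeries.X) -
        (D.map (fun e => 1 - (PowerSeries.X : PowerSeries ℚ) ^ e)).prod) :
    (D.length : ℚ) = ∑ q ∈ Finset.Icc 1 N, lWitt n q := by
  have hm := (ArithmeticFunction.sum_eq_iff_sum_mul_moebius_eq_on (R := ℚ)
    (f := fun e => (e : ℚ) * (D.count e : ℚ)) (g := fun q => (n : ℚ) ^ q)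
    {k | 1 ≤ k ∧ k ≤ N} (by
      rintro a b hab ⟨h1, h2⟩
      exact ⟨Nat.pos_of_dvd_of_pos hab h1, (Nat.le_of_dvd h1 hab).trans h2⟩)).1
    (fun q _ hq => witt_pow n N D hD h q hq.1 hq.2)
  have hw : ∀ q ∈ Finset.Icc 1 N, lWitt n q = (D.count q : ℚ) := by
    intro q hq
    rw [Finset.mem_Icc] at hq
    have := hm q hq.1 hq
    rw [Nat.sum_divisorsAntidiagonal (fun a b => (ArithmeticFunction.moebius a : ℚ) * (n : ℚ) ^ b)]
      at this
    rw [lWitt, this]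
    have : (q : ℚ) ≠ 0 := by
      have := hq.1
      positivity
    field_simp
  rw [Finset.sum_congr rfl hw]
  clear h hm hw
  induction D with
  | nil => simp
  | cons a D ih =>
    have ha := hD a List.mem_cons_self
    rw [List.length_cons, Nat.cast_succ, ih (fun e he => hD e (List.mem_cons_of_mem _ he))]
    simp only [List.count_cons, Nat.cast_add, Finset.sum_add_distrib]
    simp [ha.1, ha.2]

theorem linalg_bound {K V : Type*} [Field K] [AddCommGroup V] [Module K V] (n : ℕ)
    (A B I : Submodule K V) (hIB : I ≤ B) (α : V →ₗ[K] (Fin n → K))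
    (hα : Function.Surjective α) (hA : A ≤ LinearMap.ker α) (hI : I ≤ LinearMap.ker α)
    [FiniteDimensional K (V ⧸ I)] :
    Module.finrank K (A ⧸ B.comap A.subtype) + n ≤ Module.finrank K (V ⧸ I) := by
  let α' : (V ⧸ I) →ₗ[K] (Fin n → K) := I.liftQ α hI
  have hα' : Function.Surjective α' := by
    intro v
    obtain ⟨x, rfl⟩ := hα v
    exact ⟨I.mkQ x, by simp [α']⟩
  have h1 := LinearMap.finrank_range_add_finrank_ker α'
  rw [LinearMap.range_eq_top.2 hα', finrank_top, Module.finrank_fin_fun] at h1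
  let β : (A ⧸ I.comap A.subtype) →ₗ[K] (V ⧸ I) := Submodule.mapQ _ _ A.subtype le_rfl
  have hβ : Function.Injective β := by
    rw [← LinearMap.ker_eq_bot]
    simp [β, Submodule.mapQ, Submodule.ker_liftQ, LinearMap.ker_comp]
  have hβk : ∀ x, β x ∈ LinearMap.ker α' := by
    intro x
    obtain ⟨x, rfl⟩ := Submodule.mkQ_surjective _ x
    have : α x = 0 := hA x.2
    simp [β, α', this]
  have h2 : Module.finrank K (A ⧸ I.comap A.subtype) ≤ Module.finrank K (LinearMap.ker α') := by
    apply LinearMap.finrank_le_finrank_of_injective (f := LinearMap.codRestrict _ β hβk)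
    intro x y hxy
    exact hβ (congrArg Subtype.val hxy)
  have : FiniteDimensional K (A ⧸ I.comap A.subtype) := Module.Finite.of_injective β hβ
  have h3 : Module.finrank K (A ⧸ B.comap A.subtype) ≤
      Module.finrank K (A ⧸ I.comap A.subtype) :=
    LinearMap.finrank_le_finrank_of_surjective
      (f := Submodule.factor (Submodule.comap_mono hIB)) (Submodule.factor_surjective _)
  omega

theorem exists_ab (K : Type) [Field K] (n : ℕ) :
    ∃ α : FreeLieAlgebra K (Fin n) →ₗ[K] (Fin n → K), (∀ x y : FreeLieAlgebra K (Fin n), α ⁅x, y⁆ = 0) ∧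
      ∀ i, α (FreeLieAlgebra.of K i) = Pi.single i 1 := by
  letI : LieRing (Fin n → K) := LieRing.ofAssociativeRing
  letI : LieAlgebra K (Fin n → K) := LieAlgebra.ofAssociativeAlgebra
  refine ⟨(FreeLieAlgebra.lift K (fun i => (Pi.single i 1 : Fin n → K)) :
    FreeLieAlgebra K (Fin n) →ₗ⁅K⁆ (Fin n → K)).toLinearMap, ?_, ?_⟩
  · intro x y
    rw [LieHom.coe_toLinearMap, LieHom.map_lie, LieRing.of_associative_ring_bracket, mul_comm,
      sub_self]
  · intro i
    rw [LieHom.coe_toLinearMap, FreeLieAlgebra.lift_of_apply]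

theorem free_lieSpan (K : Type) [Field K] (n : ℕ) :
    LieSubalgebra.lieSpan K (FreeLieAlgebra K (Fin n)) (Set.range (FreeLieAlgebra.of K)) = ⊤ := by
  set A := LieSubalgebra.lieSpan K (FreeLieAlgebra K (Fin n)) (Set.range (FreeLieAlgebra.of K))
  let f : FreeLieAlgebra K (Fin n) →ₗ⁅K⁆ A := FreeLieAlgebra.lift K
    (fun i => ⟨FreeLieAlgebra.of K i, LieSubalgebra.subset_lieSpan ⟨i, rfl⟩⟩)
  have h : A.incl.comp f = LieHom.id := by
    ext i
    simp [f]
  rw [eq_top_iff]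
  intro x _
  have := congrArg (fun g : FreeLieAlgebra K (Fin n) →ₗ⁅K⁆ FreeLieAlgebra K (Fin n) => g x) h
  simp only [LieHom.comp_apply, LieHom.id_apply] at this
  rw [← this]
  exact (f x).2

theorem quot_bound (K : Type) [Field K] (n N : ℕ) :
    FiniteDimensional K (FreeLieAlgebra K (Fin n) ⧸
      (lowerCentralSeries K (FreeLieAlgebra K (Fin n)) (FreeLieAlgebra K (Fin n)) N).toSubmodule) ∧
    (Module.finrank K (FreeLieAlgebra K (Fin n) ⧸
      (lowerCentralSeries K (FreeLieAlgebra K (Fin n)) (FreeLieAlgebra K (Fin n)) N).toSubmodule)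
      : ℚ) ≤ ∑ q ∈ Finset.Icc 1 N, lWitt n q := by
  let F := FreeLieAlgebra K (Fin n)
  let I : LieIdeal K F := lowerCentralSeries K F F N
  let ρ : F →ₗ⁅K⁆ (F ⧸ I) :=
    { (LieSubmodule.Quotient.mk' I : F →ₗ[K] F ⧸ I) with
      map_lie' := fun {x y} => LieSubmodule.Quotient.mk_bracket I x y }
  have hρ : Function.Surjective ρ := LieSubmodule.Quotient.surjective_mk' I
  have hN : lowerCentralSeries K (F ⧸ I) (F ⧸ I) N = ⊥ := by
    rw [← LieIdeal.lowerCentralSeries_map_eq N hρ, LieIdeal.map_eq_bot_iff]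
    intro x hx
    rw [LieHom.mem_ker]
    exact (LieSubmodule.Quotient.mk_eq_zero' (N := I)).2 hx
  let S : List ((F ⧸ I) × ℕ) := (List.finRange n).map (fun i => (ρ (FreeLieAlgebra.of K i), 1))
  obtain ⟨D, hD, hdvd, s, hs, hspan⟩ := main_elim N hN N 1 (by omega) le_rfl _ S (by
    intro p hp
    obtain ⟨i, -, rfl⟩ := List.mem_map.1 hp
    simp) rfl
  have hg : genf S = 1 - PowerSeries.C (n : ℚ) * PowerSeries.X := by
    simp [genf, S, Function.comp_def]
  rw [hg] at hdvd
  have htop : (⊤ : Submodule K (F ⧸ I)) ≤ Submodule.span K {x | x ∈ s} := by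
    refine le_trans ?_ hspan
    intro y _
    obtain ⟨x, rfl⟩ := hρ y
    have hx : x ∈ LieSubalgebra.lieSpan K F (Set.range (FreeLieAlgebra.of K)) := by
      rw [free_lieSpan]; exact LieSubalgebra.mem_top x
    have h2 : ρ x ∈ (LieSubalgebra.lieSpan K F (Set.range (FreeLieAlgebra.of K))).map ρ :=
      ⟨x, hx, rfl⟩
    rw [LieSubalgebra.map_lieSpan] at h2
    refine LieSubalgebra.lieSpan_mono ?_ h2
    rintro _ ⟨_, ⟨i, rfl⟩, rfl⟩
    exact ⟨(ρ (FreeLieAlgebra.of K i), 1), List.mem_map.2 ⟨i, List.mem_finRange i, rfl⟩, rfl⟩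
  classical
  have hset : {x | x ∈ s} = ((s.toFinset : Finset (F ⧸ I)) : Set (F ⧸ I)) := by ext; simp
  rw [hset] at htop
  have hfd : FiniteDimensional K (F ⧸ I) :=
    ⟨⟨s.toFinset, top_le_iff.1 htop⟩⟩
  refine ⟨hfd, ?_⟩
  rw [← witt_count n N D hD hdvd]
  have h3 : Module.finrank K (F ⧸ I) ≤ D.length := by
    rw [← finrank_top, ← top_le_iff.1 htop]
    exact (finrank_span_finset_le_card _).trans ((List.toFinset_card_le s).trans hs)
  exact_mod_cast h3

theorem stmt5 (K : Type) [Field K] [CharZero K] (L : Type) [LieRing L] [LieAlgebra K L]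
    [FiniteDimensional K L] (c n : ℕ) (hc : 1 ≤ c)
    (hclass : lowerCentralSeries K L L c = ⊥)
    (hclass' : lowerCentralSeries K L L (c - 1) ≠ ⊥)
    (π : FreeLieAlgebra K (Fin n) →ₗ⁅K⁆ L) (hπ : Function.Surjective π) :
    (Module.finrank K (schurMult K π.ker) : ℚ) ≤ ∑ j ∈ Finset.Icc 1 c, lWitt n (j + 1) := by
  obtain ⟨hfd, hle⟩ := quot_bound K n (c + 1)
  obtain ⟨α, hα, hαi⟩ := exists_ab K n
  have hker : lowerCentralSeries K (FreeLieAlgebra K (Fin n)) (FreeLieAlgebra K (Fin n)) c ≤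
      π.ker := by
    rw [← LieIdeal.map_eq_bot_iff, LieIdeal.lowerCentralSeries_map_eq c hπ, hclass]
  have h1 : (lowerCentralSeries K (FreeLieAlgebra K (Fin n))
      (FreeLieAlgebra K (Fin n)) 1).toSubmodule ≤ LinearMap.ker α := by
    rw [lowerCentralSeries_succ, LieSubmodule.lieIdeal_oper_eq_linear_span', Submodule.span_le]
    rintro _ ⟨x, -, y, -, rfl⟩
    exact hα x y
  have hsurj : Function.Surjective α := by
    rw [← LinearMap.range_eq_top, eq_top_iff, ← (Pi.basisFun K (Fin n)).span_eq, Submodule.span_le]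
    rintro _ ⟨i, rfl⟩
    exact ⟨FreeLieAlgebra.of K i, by rw [hαi]; simp⟩
  have hb := linalg_bound n
    (lowerCentralSeries K (FreeLieAlgebra K (Fin n)) (FreeLieAlgebra K (Fin n)) 1 ⊓
      π.ker).toSubmodule
    (⁅(⊤ : LieIdeal K (FreeLieAlgebra K (Fin n))), π.ker⁆).toSubmodule
    (lowerCentralSeries K (FreeLieAlgebra K (Fin n)) (FreeLieAlgebra K (Fin n))
      (c + 1)).toSubmodule
    (by
      rw [lowerCentralSeries_succ]
      exact LieSubmodule.mono_lie le_rfl hker) α hsurj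
    (le_trans inf_le_left h1)
    (le_trans (antitone_lowerCentralSeries K _ _ (by omega : 1 ≤ c + 1)) h1)
  have hb' : (Module.finrank K (schurMult K π.ker) : ℚ) + n ≤
      ∑ q ∈ Finset.Icc 1 (c + 1), lWitt n q := by
    refine le_trans ?_ hle
    exact_mod_cast hb
  have hsum : ∑ q ∈ Finset.Icc 1 (c + 1), lWitt n q =
      n + ∑ j ∈ Finset.Icc 1 c, lWitt n (j + 1) := by
    rw [← Finset.add_sum_Ioc_eq_sum_Icc (by omega : 1 ≤ c + 1)]
    congr 1
    · simp [lWitt]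
    · symm
      apply Finset.sum_bij (fun j _ => j + 1)
      · intro a ha; simp at ha ⊢; omega
      · intro a _ b _ h; omega
      · intro b hb; simp at hb; exact ⟨b - 1, by simp; omega, by omega⟩
      · intro a _; rfl
  rw [hsum] at hb'
  linarith
end

section
/- Let L be a Lie algebra with free presentation L ≅ F/R, let N be an ideal of L, and let S be an ideal of F with (S+R)/R ≅ N. Then there is an exact sequence 0 → (R ∩ [F,S])/([F,R] ∩ [F,S]) → M(L) → M(L/N) → (N ∩ L^2)/[N,L] → 0. -/
open LieModule Finset

/-- Map between quotients of submodules induced by a linear map. -/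
noncomputable def quotMapAux {K V W : Type*} [Field K] [AddCommGroup V] [Module K V]
    [AddCommGroup W] [Module K W] (p : V →ₗ[K] W) (A B : Submodule K V) (C D : Submodule K W)
    (h1 : ∀ x ∈ A, p x ∈ C) (h2 : ∀ x ∈ B, p x ∈ D) :
    (A ⧸ B.comap A.subtype) →ₗ[K] (C ⧸ D.comap C.subtype) :=
  Submodule.mapQ _ _ (p.restrict h1) (fun _ hx => h2 _ hx)

theorem quotMapAux_mk {K V W : Type*} [Field K] [AddCommGroup V] [Module K V]
    [AddCommGroup W] [Module K W] (p : V →ₗ[K] W) (A B : Submodule K V) (C D : Submodule K W)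
    (h1 : ∀ x ∈ A, p x ∈ C) (h2 : ∀ x ∈ B, p x ∈ D) (x : V) (hx : x ∈ A) :
    quotMapAux p A B C D h1 h2 (Submodule.Quotient.mk ⟨x, hx⟩)
      = Submodule.Quotient.mk ⟨p x, h1 x hx⟩ := rfl

theorem linAux {K V W : Type*} [Field K] [AddCommGroup V] [Module K V]
    [AddCommGroup W] [Module K W] (p : V →ₗ[K] W)
    (D R S P Q A1 B1 A2 A3 B3 : Submodule K V) (N D' E' A4 : Submodule K W)
    (hR : ∀ x, x ∈ R ↔ p x = 0)
    (hPR : P ≤ R) (hPD : P ≤ D) (hQD : Q ≤ D) (hQS : Q ≤ S)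
    (hN : S.map p = N) (hD : D.map p = D') (hE : Q.map p = E')
    (hA1 : A1 = R ⊓ Q) (hB1 : B1 = P ⊓ Q) (hA2 : A2 = D ⊓ R) (hA3 : A3 = D ⊓ (S ⊔ R))
    (hB3 : B3 = Q ⊔ P) (hA4 : A4 = N ⊓ D') :
    ∃ (f : (A1 ⧸ B1.comap A1.subtype) →ₗ[K] (A2 ⧸ P.comap A2.subtype))
      (g : (A2 ⧸ P.comap A2.subtype) →ₗ[K] (A3 ⧸ B3.comap A3.subtype))
      (h : (A3 ⧸ B3.comap A3.subtype) →ₗ[K] (A4 ⧸ E'.comap A4.subtype)),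
      Function.Injective f ∧ Function.Exact f g ∧ Function.Exact g h ∧
        Function.Surjective h := by
  subst hN hD hE hA1 hB1 hA2 hA3 hB3 hA4
  have a1 : ∀ x ∈ R ⊓ Q, (LinearMap.id : V →ₗ[K] V) x ∈ D ⊓ R := fun x hx =>
    Submodule.mem_inf.2 ⟨hQD hx.2, hx.1⟩
  have a2 : ∀ x ∈ P ⊓ Q, (LinearMap.id : V →ₗ[K] V) x ∈ P := fun x hx => hx.1
  have a3 : ∀ x ∈ D ⊓ R, (LinearMap.id : V →ₗ[K] V) x ∈ D ⊓ (S ⊔ R) := fun x hx =>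
    Submodule.mem_inf.2 ⟨hx.1, Submodule.mem_sup_right hx.2⟩
  have a4 : ∀ x ∈ P, (LinearMap.id : V →ₗ[K] V) x ∈ Q ⊔ P := fun x hx =>
    Submodule.mem_sup_right hx
  have a5 : ∀ x ∈ D ⊓ (S ⊔ R), p x ∈ S.map p ⊓ D.map p := by
    rintro x ⟨hx, hx'⟩
    obtain ⟨s, hs, r, hr, rfl⟩ := Submodule.mem_sup.1 hx'
    refine ⟨⟨s, hs, ?_⟩, ⟨_, hx, rfl⟩⟩
    rw [map_add, (hR r).1 hr, add_zero]
  have a6 : ∀ x ∈ Q ⊔ P, p x ∈ Q.map p := by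
    rintro x hx'
    obtain ⟨s, hs, r, hr, rfl⟩ := Submodule.mem_sup.1 hx'
    refine ⟨s, hs, ?_⟩
    rw [map_add, (hR r).1 (hPR hr), add_zero]
  refine ⟨quotMapAux LinearMap.id _ _ _ _ a1 a2, quotMapAux LinearMap.id _ _ _ _ a3 a4,
    quotMapAux p _ _ _ _ a5 a6, ?_, ?_, ?_, ?_⟩
  · rw [injective_iff_map_eq_zero]
    intro a
    obtain ⟨⟨x, hx⟩, rfl⟩ := Submodule.Quotient.mk_surjective _ a
    intro h
    rw [quotMapAux_mk, Submodule.Quotient.mk_eq_zero] at h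
    rw [Submodule.Quotient.mk_eq_zero]
    exact ⟨h, hx.2⟩
  · intro a
    obtain ⟨⟨x, hx⟩, rfl⟩ := Submodule.Quotient.mk_surjective _ a
    constructor
    · intro h
      rw [quotMapAux_mk, Submodule.Quotient.mk_eq_zero] at h
      obtain ⟨q, hq, r, hr, hqr⟩ := Submodule.mem_sup.1 h
      replace hqr : q + r = x := hqr
      subst hqr
      have hqR : q ∈ R := by
        have := R.sub_mem hx.2 (hPR hr)
        rwa [add_sub_cancel_right] at this
      have hm : q ∈ R ⊓ Q := Submodule.mem_inf.2 ⟨hqR, hq⟩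
      refine ⟨Submodule.Quotient.mk ⟨q, hm⟩, ?_⟩
      rw [quotMapAux_mk, Submodule.Quotient.eq]
      change q - (q + r) ∈ P
      simpa using hr
    · rintro ⟨b, hb⟩
      obtain ⟨⟨y, hy⟩, rfl⟩ := Submodule.Quotient.mk_surjective _ b
      rw [← hb]
      rw [quotMapAux_mk, quotMapAux_mk]
      rw [Submodule.Quotient.mk_eq_zero]
      exact Submodule.mem_sup_left hy.2
  · intro a
    obtain ⟨⟨x, hx⟩, rfl⟩ := Submodule.Quotient.mk_surjective _ a
    constructor
    · intro h
      rw [quotMapAux_mk, Submodule.Quotient.mk_eq_zero] at h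
      obtain ⟨q, hq, hqx⟩ := h
      replace hqx : p q = p x := hqx
      have hm : x - q ∈ D ⊓ R := Submodule.mem_inf.2
        ⟨D.sub_mem hx.1 (hQD hq), (hR _).2 (by rw [map_sub, hqx, sub_self])⟩
      refine ⟨Submodule.Quotient.mk ⟨x - q, hm⟩, ?_⟩
      rw [quotMapAux_mk, Submodule.Quotient.eq]
      change (x - q) - x ∈ Q ⊔ P
      exact Submodule.mem_sup_left (by simpa using hq)
    · rintro ⟨b, hb⟩
      obtain ⟨⟨y, hy⟩, rfl⟩ := Submodule.Quotient.mk_surjective _ b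
      rw [← hb]
      rw [quotMapAux_mk, quotMapAux_mk]
      rw [Submodule.Quotient.mk_eq_zero]
      change p y ∈ Q.map p
      rw [(hR y).1 hy.2]
      exact Submodule.zero_mem _
  · intro a
    obtain ⟨⟨x, hx⟩, rfl⟩ := Submodule.Quotient.mk_surjective _ a
    obtain ⟨⟨s, hs, hsx⟩, ⟨d, hd, hdx⟩⟩ := Submodule.mem_inf.1 hx
    have hm : d ∈ D ⊓ (S ⊔ R) := by
      refine Submodule.mem_inf.2 ⟨hd, Submodule.mem_sup.2 ⟨s, hs, d - s, ?_, by abel⟩⟩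
      exact (hR _).2 (by rw [map_sub, hdx, hsx, sub_self])
    refine ⟨Submodule.Quotient.mk ⟨d, hm⟩, ?_⟩
    rw [quotMapAux_mk]
    congr 1
    exact Subtype.ext hdx

theorem stmt9 (K : Type) [Field K] (L : Type) [LieRing L] [LieAlgebra K L]
    (X : Type) (π : FreeLieAlgebra K X →ₗ⁅K⁆ L) (hπ : Function.Surjective π)
    (N : LieIdeal K L) (S : LieIdeal K (FreeLieAlgebra K X)) (hS : LieIdeal.map π S = N) :
    ∃ (f : lieIdealQuot K (π.ker ⊓ ⁅(⊤ : LieIdeal K (FreeLieAlgebra K X)), S⁆)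
            (⁅(⊤ : LieIdeal K (FreeLieAlgebra K X)), π.ker⁆ ⊓
              ⁅(⊤ : LieIdeal K (FreeLieAlgebra K X)), S⁆) →ₗ[K] schurMult K π.ker)
      (g : schurMult K π.ker →ₗ[K]
        lieIdealQuot K
          (lowerCentralSeries K (FreeLieAlgebra K X) (FreeLieAlgebra K X) 1 ⊓ (S ⊔ π.ker))
          ⁅(⊤ : LieIdeal K (FreeLieAlgebra K X)), S ⊔ π.ker⁆)
      (h : lieIdealQuot K
          (lowerCentralSeries K (FreeLieAlgebra K X) (FreeLieAlgebra K X) 1 ⊓ (S ⊔ π.ker))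
          ⁅(⊤ : LieIdeal K (FreeLieAlgebra K X)), S ⊔ π.ker⁆ →ₗ[K]
        lieIdealQuot K (N ⊓ lowerCentralSeries K L L 1) ⁅(⊤ : LieIdeal K L), N⁆),
      Function.Injective f ∧ Function.Exact f g ∧ Function.Exact g h ∧
        Function.Surjective h := by
  have hlcs : ∀ (M : Type) [LieRing M] [LieAlgebra K M],
      lowerCentralSeries K M M 1 = ⁅(⊤ : LieIdeal K M), (⊤ : LieIdeal K M)⁆ := fun M _ _ => by
    rw [lowerCentralSeries_succ, lowerCentralSeries_zero]
  have hmap : ∀ I : LieIdeal K (FreeLieAlgebra K X),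
      I.toSubmodule.map (π : FreeLieAlgebra K X →ₗ[K] L) = (LieIdeal.map π I).toSubmodule :=
    fun I => (LieIdeal.coe_map_of_surjective hπ).symm
  have htop : LieIdeal.map π ⊤ = ⊤ := by
    rw [← LieHom.idealRange_eq_map, LieHom.idealRange_eq_top_of_surjective π hπ]
  have hbr : ∀ I : LieIdeal K (FreeLieAlgebra K X),
      LieIdeal.map π ⁅(⊤ : LieIdeal K (FreeLieAlgebra K X)), I⁆
        = ⁅(⊤ : LieIdeal K L), LieIdeal.map π I⁆ := fun I => by
    rw [LieIdeal.map_bracket_eq π hπ, htop]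
  refine linAux (π : FreeLieAlgebra K X →ₗ[K] L)
    (lowerCentralSeries K (FreeLieAlgebra K X) (FreeLieAlgebra K X) 1).toSubmodule
    π.ker.toSubmodule S.toSubmodule _
    ⁅(⊤ : LieIdeal K (FreeLieAlgebra K X)), S⁆.toSubmodule _ _ _ _ _
    N.toSubmodule (lowerCentralSeries K L L 1).toSubmodule _ _
    ?_ ?_ ?_ ?_ ?_ ?_ ?_ ?_ ?_ ?_ ?_ ?_ ?_ ?_
  · exact fun x => LieHom.mem_ker
  · exact LieSubmodule.lie_le_right _ _
  · rw [hlcs]; exact LieSubmodule.mono_lie_right _ le_top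
  · rw [hlcs]; exact LieSubmodule.mono_lie_right _ le_top
  · exact LieSubmodule.lie_le_right _ _
  · rw [hmap, hS]
  · rw [hmap, hlcs, hlcs, hbr, htop]
  · rw [hmap, hbr, hS]
  · simp
  · simp
  · simp
  · simp
  · rw [LieSubmodule.lie_sup]; simp
  · simp
end

section
/- Every nonzero ideal R of a free Lie algebra F on at least one generator over a field is itself a free Lie algebra. -/
open LieModule Finset

namespace SW

open FreeLieAlgebra

section eps
variable {K L : Type} [Field K] [LieRing L] [LieAlgebra K L]

/-- Square-zero extension of a Lie algebra by its adjoint module. -/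
@[ext] structure Eps (L : Type) where
  a : L
  b : L

/-- underlying product -/
def Eps.toProd : Eps L ≃ L × L where
  toFun x := ⟨x.a, x.b⟩
  invFun x := ⟨x.1, x.2⟩
  left_inv _ := rfl
  right_inv _ := rfl

instance : AddCommGroup (Eps L) := Eps.toProd.addCommGroup
instance : Module K (Eps L) := Eps.toProd.module K
instance : Bracket (Eps L) (Eps L) where
  bracket x y := ⟨⁅x.a, y.a⁆, ⁅x.a, y.b⁆ + ⁅x.b, y.a⁆⟩
lemma Eps.zero_mk : (0 : Eps L) = ⟨0, 0⟩ := rfl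
lemma Eps.add_mk (x y : Eps L) : x + y = ⟨x.a + y.a, x.b + y.b⟩ := rfl
lemma Eps.smul_mk (t : K) (x : Eps L) : t • x = ⟨t • x.a, t • x.b⟩ := rfl
lemma Eps.lie_mk (x y : Eps L) : ⁅x, y⁆ = ⟨⁅x.a, y.a⁆, ⁅x.a, y.b⁆ + ⁅x.b, y.a⁆⟩ := rfl

instance : LieRing (Eps L) where
  add_lie _ _ _ := by simp [Eps.add_mk, Eps.lie_mk]; abel
  lie_add _ _ _ := by simp [Eps.add_mk, Eps.lie_mk]; abel
  lie_self x := by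
    simp only [Eps.lie_mk, Eps.zero_mk, lie_self, Eps.mk.injEq, true_and]
    rw [← lie_skew x.a x.b]; abel
  leibniz_lie x y z := by
    simp only [Eps.add_mk, Eps.lie_mk, Eps.mk.injEq, lie_add, add_lie]
    refine ⟨leibniz_lie _ _ _, ?_⟩
    rw [leibniz_lie x.a y.a z.b, leibniz_lie x.a y.b z.a, leibniz_lie x.b y.a z.a]; abel

instance : LieAlgebra K (Eps L) where
  lie_smul _ _ _ := by simp [Eps.smul_mk, Eps.lie_mk]

/-- A Lie algebra extended by one element acting as the derivation `D`. -/
@[ext] structure Ext (K L : Type) [Field K] [LieRing L] [LieAlgebra K L]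
    (D : L →ₗ[K] L) (hD : ∀ x y, D ⁅x, y⁆ = ⁅x, D y⁆ + ⁅D x, y⁆) where
  c : K
  l : L

variable {D : L →ₗ[K] L} {hD : ∀ x y, D ⁅x, y⁆ = ⁅x, D y⁆ + ⁅D x, y⁆}

/-- underlying product -/
def Ext.toProd : Ext K L D hD ≃ K × L where
  toFun x := ⟨x.c, x.l⟩
  invFun x := ⟨x.1, x.2⟩
  left_inv _ := rfl
  right_inv _ := rfl

instance : AddCommGroup (Ext K L D hD) := Ext.toProd.addCommGroup
instance : Module K (Ext K L D hD) := Ext.toProd.module K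
instance : Bracket (Ext K L D hD) (Ext K L D hD) where
  bracket x y := ⟨0, ⁅x.l, y.l⁆ + x.c • D y.l - y.c • D x.l⟩
lemma Ext.zero_mk : (0 : Ext K L D hD) = ⟨0, 0⟩ := rfl
lemma Ext.add_mk (x y : Ext K L D hD) : x + y = ⟨x.c + y.c, x.l + y.l⟩ := rfl
lemma Ext.smul_mk (t : K) (x : Ext K L D hD) : t • x = ⟨t * x.c, t • x.l⟩ := rfl
lemma Ext.lie_mk (x y : Ext K L D hD) :
    ⁅x, y⁆ = ⟨0, ⁅x.l, y.l⁆ + x.c • D y.l - y.c • D x.l⟩ := rfl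

instance : LieRing (Ext K L D hD) where
  add_lie _ _ _ := by simp [Ext.add_mk, Ext.lie_mk, add_smul]; abel
  lie_add _ _ _ := by simp [Ext.add_mk, Ext.lie_mk, add_smul]; abel
  lie_self x := by simp [Ext.lie_mk, Ext.zero_mk]
  leibniz_lie x y z := by
    simp only [Ext.add_mk, Ext.lie_mk, Ext.mk.injEq, add_zero, true_and, lie_add, add_lie,
      lie_sub, sub_lie, lie_smul, smul_lie, map_add, map_sub, map_smul, hD, zero_smul,
      smul_add, smul_sub, sub_zero]
    rw [leibniz_lie x.l y.l z.l, ← lie_skew (D x.l) y.l, smul_comm x.c y.c,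
      smul_comm z.c y.c, smul_comm z.c x.c]
    simp only [smul_neg]
    abel

instance : LieAlgebra K (Ext K L D hD) where
  lie_smul t x y := by
    simp only [Ext.smul_mk, Ext.lie_mk, lie_smul, map_smul, smul_add, smul_sub, mul_zero,
      mul_smul, smul_comm t]
end eps

variable {K : Type} [Field K]

theorem free_ind {X : Type} {P : FreeLieAlgebra K X → Prop}
    (hof : ∀ x, P (of K x)) (h0 : P 0) (hadd : ∀ a b, P a → P b → P (a + b))
    (hsmul : ∀ (t : K) a, P a → P (t • a)) (hlie : ∀ a b, P a → P b → P ⁅a, b⁆)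
    (a : FreeLieAlgebra K X) : P a := by
  let S : LieSubalgebra K (FreeLieAlgebra K X) :=
    { carrier := {a | P a}
      add_mem' := fun {a b} ha hb => hadd a b ha hb
      zero_mem' := h0
      smul_mem' := fun t a ha => hsmul t a ha
      lie_mem' := fun {a b} ha hb => hlie a b ha hb }
  let f : FreeLieAlgebra K X →ₗ⁅K⁆ S := lift K (fun x => (⟨of K x, hof x⟩ : S))
  have h : S.incl.comp f = LieHom.id := by
    apply FreeLieAlgebra.hom_ext
    intro x
    simp [f]
  have h2 : ((f a : S) : FreeLieAlgebra K X) = a := by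
    simpa using congrArg (fun g : FreeLieAlgebra K X →ₗ⁅K⁆ FreeLieAlgebra K X => g a) h
  rw [← h2]
  exact (f a).2

theorem exists_deriv {X : Type} (d : X → FreeLieAlgebra K X) :
    ∃ D : FreeLieAlgebra K X →ₗ[K] FreeLieAlgebra K X,
      (∀ x y, D ⁅x, y⁆ = ⁅x, D y⁆ + ⁅D x, y⁆) ∧ ∀ x, D (of K x) = d x := by
  let f : FreeLieAlgebra K X →ₗ⁅K⁆ Eps (FreeLieAlgebra K X) :=
    lift K (fun x => (⟨of K x, d x⟩ : Eps (FreeLieAlgebra K X)))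
  have hof : ∀ x, f (of K x) = ⟨of K x, d x⟩ := fun x => lift_of_apply _ _
  have ha : ∀ p, (f p).a = p := by
    intro p
    induction p using free_ind with
    | hof x => rw [hof]
    | h0 => rw [map_zero]; rfl
    | hadd a b ha hb => rw [map_add, Eps.add_mk, ha, hb]
    | hsmul t a ha => rw [map_smul, Eps.smul_mk, ha]
    | hlie a b ha hb => rw [LieHom.map_lie, Eps.lie_mk, ha, hb]
  refine ⟨{ toFun := fun p => (f p).b, map_add' := ?_, map_smul' := ?_ }, ?_, ?_⟩
  · intro p q; rw [map_add, Eps.add_mk]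
  · intro t q; rw [map_smul, Eps.smul_mk]; rfl
  · intro p q
    simp only [LinearMap.coe_mk, AddHom.coe_mk]
    rw [LieHom.map_lie, Eps.lie_mk, ha, ha]
  · intro x
    simp only [LinearMap.coe_mk, AddHom.coe_mk]
    rw [hof]

/-- The weight filtration on a free Lie algebra. -/
inductive Fil {X : Type} (w : X → ℕ) : ℕ → FreeLieAlgebra K X → Prop
  | of (n : ℕ) (x : X) : w x ≤ n → Fil w n (of K x)
  | zero (n : ℕ) : Fil w n 0
  | add (n : ℕ) (a b : FreeLieAlgebra K X) : Fil w n a → Fil w n b → Fil w n (a + b)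
  | smul (n : ℕ) (t : K) (a : FreeLieAlgebra K X) : Fil w n a → Fil w n (t • a)
  | lie (n i j : ℕ) (a b : FreeLieAlgebra K X) : Fil w i a → Fil w j b → i + j ≤ n →
      Fil w n ⁅a, b⁆

section fil
variable {X Y Z : Type} {w : X → ℕ} {v : Y → ℕ} {u : Z → ℕ}

theorem Fil.mono {m n : ℕ} {a : FreeLieAlgebra K X} (h : Fil w m a) (hmn : m ≤ n) :
    Fil w n a := by
  induction h generalizing n with
  | of m x hx => exact Fil.of n x (hx.trans hmn)
  | zero m => exact Fil.zero n
  | add m a b _ _ ha hb => exact Fil.add n a b (ha hmn) (hb hmn)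
  | smul m t a _ ha => exact Fil.smul n t a (ha hmn)
  | lie m i j a b h1 h2 h3 _ _ => exact Fil.lie n i j a b h1 h2 (h3.trans hmn)

theorem Fil.neg {n : ℕ} {a : FreeLieAlgebra K X} (h : Fil w n a) : Fil w n (-a) := by
  simpa using Fil.smul n (-1 : K) a h

theorem Fil.sub {n : ℕ} {a b : FreeLieAlgebra K X} (h : Fil w n a) (h' : Fil w n b) :
    Fil w n (a - b) := by
  rw [sub_eq_add_neg]; exact Fil.add _ _ _ h h'.neg

theorem Fil.eq_zero (hw : ∀ x, 1 ≤ w x) {n : ℕ} {a : FreeLieAlgebra K X} (h : Fil w n a)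
    (hn : n = 0) : a = 0 := by
  induction h with
  | of m x hx => have := hw x; omega
  | zero m => rfl
  | add m a b _ _ ha hb => rw [ha hn, hb hn, add_zero]
  | smul m t a _ ha => rw [ha hn, smul_zero]
  | lie m i j a b h1 h2 h3 ha hb => rw [ha (by omega), zero_lie]

theorem Fil.exists (w : X → ℕ) (a : FreeLieAlgebra K X) : ∃ n, Fil w n a := by
  induction a using free_ind with
  | hof x => exact ⟨w x, Fil.of _ _ le_rfl⟩
  | h0 => exact ⟨0, Fil.zero _⟩
  | hadd a b ha hb =>
    obtain ⟨m, hm⟩ := ha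
    obtain ⟨n, hn⟩ := hb
    exact ⟨m + n, Fil.add _ _ _ (hm.mono (by omega)) (hn.mono (by omega))⟩
  | hsmul t a ha => obtain ⟨m, hm⟩ := ha; exact ⟨m, Fil.smul _ _ _ hm⟩
  | hlie a b ha hb =>
    obtain ⟨m, hm⟩ := ha
    obtain ⟨n, hn⟩ := hb
    exact ⟨m + n, Fil.lie _ m n _ _ hm hn le_rfl⟩

/-- A homomorphism which is filtered on generators is filtered. -/
theorem Fil.map (f : FreeLieAlgebra K X →ₗ⁅K⁆ FreeLieAlgebra K Y)
    (hf : ∀ x, Fil v (w x) (f (FreeLieAlgebra.of K x))) {n : ℕ} {a : FreeLieAlgebra K X}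
    (h : Fil w n a) : Fil v n (f a) := by
  induction h with
  | of m x hx => exact (hf x).mono hx
  | zero m => rw [map_zero]; exact Fil.zero _
  | add m a b _ _ ha hb => rw [map_add]; exact Fil.add _ _ _ ha hb
  | smul m t a _ ha => rw [map_smul]; exact Fil.smul _ _ _ ha
  | lie m i j a b h1 h2 h3 ha hb => rw [LieHom.map_lie]; exact Fil.lie _ i j _ _ ha hb h3

/-- Strictly filtered homomorphisms. -/
def Strict (w : X → ℕ) (v : Y → ℕ) (f : FreeLieAlgebra K X →ₗ⁅K⁆ FreeLieAlgebra K Y) : Prop :=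
  ∀ n a, Fil v n (f a) ↔ Fil w n a

theorem Strict.of_retract (f : FreeLieAlgebra K X →ₗ⁅K⁆ FreeLieAlgebra K Y)
    (g : FreeLieAlgebra K Y →ₗ⁅K⁆ FreeLieAlgebra K X)
    (hf : ∀ x, Fil v (w x) (f (of K x))) (hg : ∀ y, Fil w (v y) (g (of K y)))
    (hgf : ∀ x, g (f (of K x)) = of K x) : Strict w v f := by
  have h : g.comp f = LieHom.id := by
    apply FreeLieAlgebra.hom_ext
    intro x
    simp [hgf]
  have h2 : ∀ a, g (f a) = a := fun a => by
    simpa using congrArg (fun g : FreeLieAlgebra K X →ₗ⁅K⁆ FreeLieAlgebra K X => g a) h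
  intro n a
  refine ⟨fun ha => ?_, fun ha => ha.map f hf⟩
  rw [← h2 a]
  exact ha.map g hg

theorem Strict.comp {f : FreeLieAlgebra K X →ₗ⁅K⁆ FreeLieAlgebra K Y}
    {g : FreeLieAlgebra K Y →ₗ⁅K⁆ FreeLieAlgebra K Z} (hg : Strict v u g) (hf : Strict w v f) :
    Strict w u (g.comp f) := by
  intro n a
  rw [LieHom.comp_apply, hg, hf]

theorem Strict.injective (hw : ∀ x, 1 ≤ w x)
    {f : FreeLieAlgebra K X →ₗ⁅K⁆ FreeLieAlgebra K Y} (hf : Strict w v f) :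
    Function.Injective f := by
  rw [injective_iff_map_eq_zero]
  intro a ha
  refine Fil.eq_zero hw ((hf 0 a).1 ?_) rfl
  rw [ha]; exact Fil.zero _

/-- The map of free Lie algebras induced by a map of generators. -/
noncomputable def mp (j : X → Y) : FreeLieAlgebra K X →ₗ⁅K⁆ FreeLieAlgebra K Y :=
  lift K (fun x => of K (j x))

theorem mp_of (j : X → Y) (x : X) : mp (K := K) j (of K x) = of K (j x) := lift_of_apply _ _

theorem mp_strict (j : X → Y) (hj : Function.Injective j) (h : ∀ x, v (j x) = w x) :
    Strict (K := K) w v (mp j) := by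
  classical
  refine Strict.of_retract (mp j)
    (lift K (fun y => if hy : ∃ x, j x = y then of K hy.choose else 0)) ?_ ?_ ?_
  · intro x; rw [mp_of]; exact Fil.of _ _ (h x).le
  · intro y
    rw [lift_of_apply]
    split_ifs with hy
    · refine Fil.of _ _ ?_
      rw [← h, hy.choose_spec]
    · exact Fil.zero _
  · intro x
    rw [mp_of, lift_of_apply]
    have hy : ∃ x', j x' = j x := ⟨x, rfl⟩
    rw [dif_pos hy, hj hy.choose_spec]

theorem perturb (hw : ∀ x, 1 ≤ w x) (f g : FreeLieAlgebra K X →ₗ⁅K⁆ FreeLieAlgebra K Y)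
    (hf : ∀ x, Fil v (w x) (f (of K x)))
    (hfg : ∀ x, Fil v (w x - 1) (f (of K x) - g (of K x))) {n : ℕ} {a : FreeLieAlgebra K X}
    (h : Fil w n a) : Fil v (n - 1) (f a - g a) := by
  have hg : ∀ x, Fil v (w x) (g (of K x)) := fun x => by
    simpa using (hf x).sub ((hfg x).mono (Nat.sub_le _ _))
  induction h with
  | of m x hx => exact (hfg x).mono (by omega)
  | zero m => simpa using Fil.zero _
  | add m a b _ _ ha hb =>
    rw [map_add, map_add, add_sub_add_comm]; exact Fil.add _ _ _ ha hb
  | smul m t a _ ha => rw [map_smul, map_smul, ← smul_sub]; exact Fil.smul _ _ _ ha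
  | lie m i j a b h1 h2 h3 ha hb =>
    by_cases hi : i = 0
    · rw [h1.eq_zero hw hi]; simpa using Fil.zero _
    by_cases hj : j = 0
    · rw [h2.eq_zero hw hj]; simpa using Fil.zero _
    have : f ⁅a, b⁆ - g ⁅a, b⁆ = ⁅f a - g a, f b⁆ + ⁅g a, f b - g b⁆ := by
      simp only [LieHom.map_lie, sub_lie, lie_sub]; abel
    rw [this]
    exact Fil.add _ _ _ (Fil.lie _ (i - 1) j _ _ ha (h2.map f hf) (by omega))
      (Fil.lie _ i (j - 1) _ _ (h1.map g hg) hb (by omega))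

theorem Strict.perturb (hw : ∀ x, 1 ≤ w x) {f g : FreeLieAlgebra K X →ₗ⁅K⁆ FreeLieAlgebra K Y}
    (hf : Strict w v f)
    (hfg : ∀ x, Fil v (w x - 1) (f (of K x) - g (of K x))) : Strict w v g := by
  have hf' : ∀ x, Fil v (w x) (f (of K x)) := fun x => (hf _ _).2 (Fil.of _ _ le_rfl)
  have key := fun (n : ℕ) (a : FreeLieAlgebra K X) (h : Fil w n a) =>
    SW.perturb hw f g hf' hfg h
  intro n a
  constructor
  · intro h
    obtain ⟨m, hm⟩ := Fil.exists w a
    induction m with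
    | zero => exact hm.mono (Nat.zero_le _)
    | succ m ih =>
      by_cases hmn : m + 1 ≤ n
      · exact hm.mono hmn
      · refine ih ((hf m a).1 ?_)
        have := Fil.add _ _ _ (key _ _ hm) (h.mono (n := m) (by omega))
        simpa using this
  · intro h
    have := Fil.sub ((hf n a).2 h) ((key _ _ h).mono (Nat.sub_le _ _))
    simpa using this

end fil

section elim
variable {X : Type} {w : X → ℕ}

/-- Lazard elimination of one generator. -/
theorem elim (w : X → ℕ) (b : X) :
    ∃ ψ : FreeLieAlgebra K (ℕ × {x : X // x ≠ b}) →ₗ⁅K⁆ FreeLieAlgebra K X,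
      Strict (fun p : ℕ × {x : X // x ≠ b} => w p.2 + p.1 * w b) w ψ ∧
      (∀ a : {x : X // x ≠ b}, ψ (of K (0, a)) = of K (a : X)) ∧
      ∀ z, ∃ (β : K) (z' : FreeLieAlgebra K (ℕ × {x : X // x ≠ b})), z = β • of K b + ψ z' := by
  classical
  obtain ⟨D, hD, hDof⟩ := exists_deriv (K := K)
    (fun p : ℕ × {x : X // x ≠ b} => of K (p.1 + 1, p.2))
  set w' : ℕ × {x : X // x ≠ b} → ℕ := fun p => w p.2 + p.1 * w b with hw'
  let ad : ℕ → FreeLieAlgebra K X → FreeLieAlgebra K X := fun n a => (fun c => ⁅of K b, c⁆)^[n] a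
  have ad0 : ∀ a, ad 0 a = a := fun a => rfl
  have adS : ∀ n a, ad (n + 1) a = ⁅of K b, ad n a⁆ := fun n a =>
    Function.iterate_succ_apply' _ _ _
  let ψ : FreeLieAlgebra K (ℕ × {x : X // x ≠ b}) →ₗ⁅K⁆ FreeLieAlgebra K X :=
    lift K (fun p => ad p.1 (of K (p.2 : X)))
  have hψ : ∀ n a, ψ (of K (n, a)) = ad n (of K (a : X)) := fun n a => lift_of_apply _ _
  let τ : FreeLieAlgebra K X →ₗ⁅K⁆ Ext K (FreeLieAlgebra K (ℕ × {x : X // x ≠ b})) D hD :=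
    lift K (fun x => if h : x = b then ⟨1, 0⟩ else ⟨0, of K (0, ⟨x, h⟩)⟩)
  have hτb : τ (of K b) = ⟨1, 0⟩ := by
    simp only [τ]; rw [lift_of_apply, dif_pos rfl]
  have hτa : ∀ a : {x : X // x ≠ b}, τ (of K (a : X)) = ⟨0, of K (0, a)⟩ := fun a => by
    simp only [τ]; rw [lift_of_apply, dif_neg a.2]
  -- the image of a generator
  have hτψ : ∀ n a, τ (ad n (of K ((a : {x : X // x ≠ b}) : X))) = ⟨0, of K (n, a)⟩ := by
    intro n a
    induction n with
    | zero => exact hτa a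
    | succ n ih => rw [adS, LieHom.map_lie, ih, hτb, Ext.lie_mk]; simp [hDof]
  have hτψ' : ∀ z, τ (ψ z) = ⟨0, z⟩ := by
    intro z
    induction z using free_ind with
    | hof p => rw [hψ, hτψ]
    | h0 => simp only [map_zero]; rfl
    | hadd x y hx hy => rw [map_add, map_add, hx, hy, Ext.add_mk, add_zero]
    | hsmul t x hx => rw [map_smul, map_smul, hx, Ext.smul_mk, mul_zero]
    | hlie x y hx hy => rw [LieHom.map_lie, LieHom.map_lie, hx, hy, Ext.lie_mk]; simp
  have hDfil : ∀ n z, Fil w' n z → Fil w' (n + w b) (D z) := by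
    intro n z h
    induction h with
    | of m x hx =>
      rw [hDof]
      refine Fil.of _ _ ?_
      simp only [hw'] at hx ⊢
      rw [add_mul, one_mul]
      omega
    | zero m => rw [map_zero]; exact Fil.zero _
    | add m a b _ _ ha hb => rw [map_add]; exact Fil.add _ _ _ ha hb
    | smul m t a _ ha => rw [map_smul]; exact Fil.smul _ _ _ ha
    | lie m i j a c h1 h2 h3 ha hb =>
      rw [hD]
      exact Fil.add _ _ _ (Fil.lie _ _ _ _ _ h1 hb (by omega))
        (Fil.lie _ _ _ _ _ ha h2 (by omega))
  have hτfil : ∀ n z, Fil w n z → Fil w' n (τ z).l ∧ ((τ z).c ≠ 0 → w b ≤ n) := by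
    intro n z h
    induction h with
    | of m x hx =>
      by_cases hxb : x = b
      · subst hxb
        rw [hτb]
        exact ⟨Fil.zero _, fun _ => hx⟩
      · rw [hτa ⟨x, hxb⟩]
        refine ⟨Fil.of _ _ ?_, fun h => absurd rfl h⟩
        simpa [hw'] using hx
    | zero m => rw [map_zero]; exact ⟨Fil.zero _, fun h => absurd rfl h⟩
    | add m a b _ _ ha hb =>
      rw [map_add, Ext.add_mk]
      refine ⟨Fil.add _ _ _ ha.1 hb.1, fun h => ?_⟩
      by_cases h' : (τ a).c = 0
      · apply hb.2
        intro h''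
        apply h
        simp [h', h'']
      · exact ha.2 h'
    | smul m t a _ ha =>
      rw [map_smul, Ext.smul_mk]
      refine ⟨Fil.smul _ _ _ ha.1, fun h => ha.2 ?_⟩
      intro h'
      apply h
      simp [h']
    | lie m i j a c h1 h2 h3 ha hc =>
      rw [LieHom.map_lie, Ext.lie_mk]
      refine ⟨Fil.sub (Fil.add _ _ _ (Fil.lie _ _ _ _ _ ha.1 hc.1 h3) ?_) ?_,
        fun h => absurd rfl h⟩
      · by_cases h : (τ a).c = 0
        · rw [h, zero_smul]; exact Fil.zero _
        · have := ha.2 h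
          exact Fil.smul _ _ _ ((hDfil _ _ hc.1).mono (by omega))
      · by_cases h : (τ c).c = 0
        · rw [h, zero_smul]; exact Fil.zero _
        · have := hc.2 h
          exact Fil.smul _ _ _ ((hDfil _ _ ha.1).mono (by omega))
  have hbψ : ∀ z, ⁅of K b, ψ z⁆ = ψ (D z) := by
    intro z
    induction z using free_ind with
    | hof p => rw [hDof, hψ, hψ, adS]
    | h0 => simp
    | hadd x y hx hy => simp only [map_add, lie_add, hx, hy]
    | hsmul t x hx => simp only [map_smul, lie_smul, hx]
    | hlie x y hx hy =>
      rw [hD, map_add, LieHom.map_lie, LieHom.map_lie, LieHom.map_lie, leibniz_lie, hx, hy,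
        add_comm]
  have hadfil : ∀ n a, Fil w (w a + n * w b) (ad n (of K a)) := by
    intro n a
    induction n with
    | zero => exact Fil.of _ _ (by omega)
    | succ n ih =>
      rw [adS]
      exact Fil.lie _ (w b) _ _ _ (Fil.of _ _ le_rfl) ih (by rw [add_mul]; omega)
  refine ⟨ψ, ?_, fun a => hψ 0 a, ?_⟩
  · intro n a
    refine ⟨fun h => ?_, fun h => h.map ψ (fun p => ?_)⟩
    swap
    · rw [show p = (p.1, p.2) from rfl, hψ]; exact hadfil _ _
    have := (hτfil _ _ h).1
    rwa [hτψ'] at this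
  · intro z
    induction z using free_ind with
    | hof x =>
      by_cases hxb : x = b
      · subst hxb; exact ⟨1, 0, by simp⟩
      · exact ⟨0, of K (0, ⟨x, hxb⟩), by rw [hψ, ad0]; simp⟩
    | h0 => exact ⟨0, 0, by simp⟩
    | hadd x y hx hy =>
      obtain ⟨β, x', rfl⟩ := hx
      obtain ⟨γ, y', rfl⟩ := hy
      exact ⟨β + γ, x' + y', by rw [map_add, add_smul]; abel⟩
    | hsmul t x hx =>
      obtain ⟨β, x', rfl⟩ := hx
      exact ⟨t * β, t • x', by rw [map_smul, smul_add, mul_smul]⟩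
    | hlie x y hx hy =>
      obtain ⟨β, x', rfl⟩ := hx
      obtain ⟨γ, y', rfl⟩ := hy
      refine ⟨0, ⁅x', y'⁆ + β • D y' - γ • D x', ?_⟩
      rw [map_sub, map_add, map_smul, map_smul, ← hbψ, ← hbψ, LieHom.map_lie]
      simp only [add_lie, lie_add, lie_smul, smul_lie, lie_self, smul_zero, zero_smul]
      rw [← lie_skew (of K b) (ψ x'), smul_neg]
      abel
end elim

section main
variable {X Y : Type}

/-- `y` is reduced: no `y e` is, modulo lower terms, a Lie polynomial in the other elements. -/
def Star (w : X → ℕ) (v : Y → ℕ) (y : Y → FreeLieAlgebra K X) : Prop :=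
  open Classical in
  ∀ e q, Fil v (v e) q → ¬ Fil w (v e - 1) (y e - lift K (Function.update y e 0) q)

theorem Star.comp {Y' : Type} {w : X → ℕ} {v : Y → ℕ} {y : Y → FreeLieAlgebra K X}
    (h : Star w v y) (j : Y' → Y) (hj : Function.Injective j) : Star w (v ∘ j) (y ∘ j) := by
  classical
  intro e q hq hh
  refine h (j e) (mp j q) (((mp_strict (w := v ∘ j) (v := v) j hj (fun _ => rfl)) _ _).2 hq) ?_
  have : ((lift K (Function.update y (j e) 0)).comp (mp (K := K) j)) =
      lift K (Function.update (y ∘ j) e 0) := by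
    apply FreeLieAlgebra.hom_ext
    intro x
    rw [LieHom.comp_apply, mp_of, lift_of_apply, lift_of_apply]
    by_cases hx : x = e
    · subst hx; simp
    · rw [Function.update_of_ne (hj.ne hx), Function.update_of_ne hx]; rfl
  have h2 := congrArg (fun g : FreeLieAlgebra K Y' →ₗ⁅K⁆ FreeLieAlgebra K X => g q) this
  simp only [LieHom.comp_apply] at h2
  have hh' : Fil w (v (j e) - 1) (y (j e) - lift K (Function.update (y ∘ j) e 0) q) := hh
  rw [← h2] at hh'
  convert hh'

/-- Data realizing `y` modulo lower terms as part of a free generating set. -/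
structure Dat (w : X → ℕ) (v : Y → ℕ) (y : Y → FreeLieAlgebra K X) where
  X' : Type
  w' : X' → ℕ
  φ : FreeLieAlgebra K X' →ₗ⁅K⁆ FreeLieAlgebra K X
  j : Y → X'
  pos : ∀ x, 1 ≤ w' x
  fin : ∀ n, {x | w' x ≤ n}.Finite
  inj : Function.Injective j
  wt : ∀ i, w' (j i) = v i
  strict : Strict w' w φ
  app : ∀ i, Fil w (v i - 1) (φ (of K (j i)) - y i)

theorem Dat.strict_of {w : X → ℕ} {v : Y → ℕ} {y : Y → FreeLieAlgebra K X}
    (hv : ∀ i, 1 ≤ v i) (d : Dat w v y) : Strict v w (lift K y) := by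
  refine Strict.perturb hv (d.strict.comp (mp_strict d.j d.inj d.wt)) ?_
  intro x
  rw [LieHom.comp_apply, mp_of, lift_of_apply]
  exact d.app x

/-- One elimination step. -/
theorem Dat.step {w : X → ℕ} {v : Y → ℕ} {y : Y → FreeLieAlgebra K X} {t c : ℕ}
    {E : Type} {u : E → ℕ} {ye : E → FreeLieAlgebra K X} (htV : ∀ e, t < u e)
    (h : ∃ (d : Dat w v y) (z : E → FreeLieAlgebra K d.X'), (∀ e, Fil d.w' (u e) (z e)) ∧
      (∀ e, Fil w (u e - 1) (d.φ (z e) - ye e)) ∧ (∀ x, x ∉ Set.range d.j → t ≤ d.w' x) ∧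
      {x | x ∉ Set.range d.j ∧ d.w' x = t}.ncard ≤ c + 1) :
    ∃ (d : Dat w v y) (z : E → FreeLieAlgebra K d.X'), (∀ e, Fil d.w' (u e) (z e)) ∧
      (∀ e, Fil w (u e - 1) (d.φ (z e) - ye e)) ∧ (∀ x, x ∉ Set.range d.j → t ≤ d.w' x) ∧
      {x | x ∉ Set.range d.j ∧ d.w' x = t}.ncard ≤ c := by
  obtain ⟨d, z, hz, hzy, ht, hc⟩ := h
  have hfin : {x | x ∉ Set.range d.j ∧ d.w' x = t}.Finite :=
    (d.fin t).subset (fun x hx => hx.2.le)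
  by_cases hb : ∃ b, b ∉ Set.range d.j ∧ d.w' b = t
  swap
  · refine ⟨d, z, hz, hzy, ht, ?_⟩
    have : {x | x ∉ Set.range d.j ∧ d.w' x = t} = ∅ := by
      ext x
      simp only [Set.mem_ofPred_eq, Set.mem_empty_iff_false, iff_false]
      exact fun hx => hb ⟨x, hx⟩
    rw [this]; simp
  obtain ⟨b, hbj, hbt⟩ := hb
  obtain ⟨ψ, hψs, hψ0, hψe⟩ := elim (K := K) d.w' b
  choose β z' hz' using fun e => hψe (z e)
  have hjb : ∀ i, d.j i ≠ b := fun i h => hbj ⟨i, h⟩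
  have hβ : ∀ e, Fil d.w' (u e - 1) (β e • of K b) := fun e =>
    Fil.smul _ _ _ (Fil.of _ _ (by have := htV e; omega))
  have hψz : ∀ e, ψ (z' e) = z e - β e • of K b := fun e => by
    conv_rhs => rw [hz' e]
    abel
  have hbpos := d.pos b
  refine ⟨⟨ℕ × {x : d.X' // x ≠ b}, fun p => d.w' p.2 + p.1 * d.w' b, d.φ.comp ψ,
    fun i => (0, ⟨d.j i, hjb i⟩), ?_, ?_, ?_, ?_, d.strict.comp hψs, ?_⟩, z', ?_, ?_, ?_, ?_⟩
  · intro p; have := d.pos p.2; omega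
  · intro n
    have h1 : (Set.Iic n ×ˢ ((fun x : {x : d.X' // x ≠ b} => (x : d.X')) ⁻¹'
        {x | d.w' x ≤ n})).Finite :=
      (Set.finite_Iic n).prod ((d.fin n).preimage Subtype.val_injective.injOn)
    refine h1.subset ?_
    rintro ⟨i, a⟩ h
    simp only [Set.mem_ofPred_eq] at h
    simp only [Set.mem_prod, Set.mem_Iic, Set.mem_preimage, Set.mem_ofPred_eq]
    constructor
    · nlinarith
    · omega
  · intro i i' h
    simp only [Prod.mk.injEq, true_and, Subtype.mk.injEq] at h
    exact d.inj h
  · intro i; simp [d.wt]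
  · intro i
    rw [LieHom.comp_apply, hψ0]
    exact d.app i
  · intro e
    rw [← hψs, hψz]
    exact (hz e).sub ((hβ e).mono (Nat.sub_le _ _))
  · intro e
    simp only [LieHom.comp_apply]
    rw [hψz, map_sub]
    have := (hzy e).sub ((d.strict _ _).2 (hβ e))
    convert this using 1
    abel
  · rintro ⟨i, a⟩ hx
    simp only
    rcases Nat.eq_zero_or_pos i with rfl | hi
    · have := ht a (by
        rintro ⟨k, hk⟩
        exact hx ⟨k, by simp [hk]⟩)
      omega
    · nlinarith
  · have hsub : (fun p : ℕ × {x : d.X' // x ≠ b} => (p.2 : d.X')) ''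
        {x | x ∉ Set.range (fun i => ((0 : ℕ), (⟨d.j i, hjb i⟩ : {x : d.X' // x ≠ b}))) ∧
          d.w' x.2 + x.1 * d.w' b = t} ⊆ {x | x ∉ Set.range d.j ∧ d.w' x = t} \ {b} := by
      rintro _ ⟨⟨i, a⟩, ⟨h1, h2⟩, rfl⟩
      have ha := d.pos a
      simp only at h2
      have hi : i = 0 := by
        by_contra hi
        have : 1 ≤ i := Nat.one_le_iff_ne_zero.2 hi
        nlinarith
      subst hi
      refine ⟨⟨?_, by simpa using h2⟩, a.2⟩
      rintro ⟨k, hk⟩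
      exact h1 ⟨k, by simp [hk]⟩
    have hinj : Set.InjOn (fun p : ℕ × {x : d.X' // x ≠ b} => (p.2 : d.X'))
        {x | x ∉ Set.range (fun i => ((0 : ℕ), (⟨d.j i, hjb i⟩ : {x : d.X' // x ≠ b}))) ∧
          d.w' x.2 + x.1 * d.w' b = t} := by
      have hz : ∀ (i : ℕ) (a : {x : d.X' // x ≠ b}), d.w' a + i * d.w' b = t → i = 0 := by
        intro i a h2
        by_contra hi
        have : 1 ≤ i := Nat.one_le_iff_ne_zero.2 hi
        have ha := d.pos a
        nlinarith
      rintro ⟨i, a⟩ h1 ⟨i', a'⟩ h2 h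
      have e1 := hz i a h1.2
      have e2 := hz i' a' h2.2
      subst e1; subst e2
      simpa [Subtype.ext_iff] using h
    have h1 := Set.ncard_le_ncard hsub (hfin.subset Set.sdiff_subset)
    rw [hinj.ncard_image] at h1
    have hmem : b ∈ {x | x ∉ Set.range d.j ∧ d.w' x = t} := ⟨hbj, hbt⟩
    rw [Set.ncard_sdiff_singleton_of_mem hmem] at h1
    simp only
    omega

theorem Dat.loop {w : X → ℕ} {v : Y → ℕ} {y : Y → FreeLieAlgebra K X} {V : ℕ}
    {E : Type} {u : E → ℕ} {ye : E → FreeLieAlgebra K X} (hV : ∀ e, V ≤ u e)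
    (h : ∃ (d : Dat w v y) (z : E → FreeLieAlgebra K d.X'), (∀ e, Fil d.w' (u e) (z e)) ∧
      (∀ e, Fil w (u e - 1) (d.φ (z e) - ye e))) (t : ℕ) (htV : t ≤ V) :
    ∃ (d : Dat w v y) (z : E → FreeLieAlgebra K d.X'), (∀ e, Fil d.w' (u e) (z e)) ∧
      (∀ e, Fil w (u e - 1) (d.φ (z e) - ye e)) ∧ (∀ x, x ∉ Set.range d.j → t ≤ d.w' x) := by
  induction t with
  | zero =>
    obtain ⟨d, z, h1, h2⟩ := h
    exact ⟨d, z, h1, h2, fun _ _ => Nat.zero_le _⟩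
  | succ t ih =>
    obtain ⟨d, z, h1, h2, h3⟩ := ih (by omega)
    have : ∀ c : ℕ, (∃ (d : Dat w v y) (z : E → FreeLieAlgebra K d.X'), (∀ e, Fil d.w' (u e) (z e)) ∧
      (∀ e, Fil w (u e - 1) (d.φ (z e) - ye e)) ∧ (∀ x, x ∉ Set.range d.j → t ≤ d.w' x) ∧
      {x | x ∉ Set.range d.j ∧ d.w' x = t}.ncard ≤ c) →
      (∃ (d : Dat w v y) (z : E → FreeLieAlgebra K d.X'), (∀ e, Fil d.w' (u e) (z e)) ∧
      (∀ e, Fil w (u e - 1) (d.φ (z e) - ye e)) ∧ (∀ x, x ∉ Set.range d.j → t ≤ d.w' x) ∧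
      {x | x ∉ Set.range d.j ∧ d.w' x = t}.ncard ≤ 0) := by
      intro c
      induction c with
      | zero => exact id
      | succ c ihc => exact fun h => ihc (Dat.step (fun e => by have := hV e; omega) h)
    obtain ⟨d, z, h1, h2, h3, h4⟩ := this _ ⟨d, z, h1, h2, h3, le_rfl⟩
    refine ⟨d, z, h1, h2, fun x hx => ?_⟩
    have hfin : {x | x ∉ Set.range d.j ∧ d.w' x = t}.Finite :=
      (d.fin t).subset (fun x hx => hx.2.le)
    have h5 := (Set.ncard_eq_zero hfin).1 (Nat.le_zero.1 h4)
    have h6 := h3 x hx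
    rcases h6.lt_or_eq with h7 | h7
    · omega
    · have : x ∈ {x | x ∉ Set.range d.j ∧ d.w' x = t} := ⟨hx, h7.symm⟩
      rw [h5] at this
      exact absurd this (Set.notMem_empty _)

/-- Elements of low weight only involve matched generators. -/
theorem low {X' : Type} {w' : X' → ℕ} {v : Y → ℕ} {j : Y → X'} {V : ℕ}
    (hwt : ∀ i, w' (j i) = v i)
    (hun : ∀ x, x ∉ Set.range j → V ≤ w' x) {n : ℕ} {a : FreeLieAlgebra K X'}
    (h : Fil w' n a) (hn : n < V) : ∃ q : FreeLieAlgebra K Y, Fil v n q ∧ mp j q = a := by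
  induction h with
  | of m x hx =>
    by_cases hxj : x ∈ Set.range j
    · obtain ⟨i, rfl⟩ := hxj
      exact ⟨of K i, Fil.of _ _ (by rw [← hwt]; exact hx), mp_of _ _⟩
    · have := hun x hxj; omega
  | zero m => exact ⟨0, Fil.zero _, map_zero _⟩
  | add m a b _ _ ha hb =>
    obtain ⟨p, hp, rfl⟩ := ha hn
    obtain ⟨q, hq, rfl⟩ := hb hn
    exact ⟨p + q, Fil.add _ _ _ hp hq, map_add _ _ _⟩
  | smul m t a _ ha =>
    obtain ⟨p, hp, rfl⟩ := ha hn
    exact ⟨t • p, Fil.smul _ _ _ hp, map_smul _ _ _⟩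
  | lie m k l a b h1 h2 h3 ha hb =>
    obtain ⟨p, hp, rfl⟩ := ha (by omega)
    obtain ⟨q, hq, rfl⟩ := hb (by omega)
    exact ⟨⁅p, q⁆, Fil.lie _ _ _ _ _ hp hq h3, LieHom.map_lie _ _ _⟩

theorem top_part {X' : Type} {w' : X' → ℕ} {v : Y → ℕ} {j : Y → X'} {V : ℕ}
    (hpos : ∀ x, 1 ≤ w' x) (hwt : ∀ i, w' (j i) = v i)
    (hun : ∀ x, x ∉ Set.range j → V ≤ w' x) {n : ℕ} {a : FreeLieAlgebra K X'}
    (h : Fil w' n a) (hn : n = V) :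
    ∃ (q : FreeLieAlgebra K Y) (α : X' →₀ K), Fil v V q ∧
      (∀ x, α x ≠ 0 → x ∉ Set.range j ∧ w' x = V) ∧
      a = mp j q + Finsupp.linearCombination K (of K) α := by
  classical
  induction h with
  | of m x hx =>
    by_cases hxj : x ∈ Set.range j
    · obtain ⟨i, rfl⟩ := hxj
      refine ⟨of K i, 0, Fil.of _ _ (by rw [← hwt, ← hn]; exact hx), by simp, ?_⟩
      rw [mp_of]; simp
    · refine ⟨0, Finsupp.single x 1, Fil.zero _, ?_, by simp⟩
      intro x' hx'
      have : x' = x := by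
        by_contra hne
        exact hx' (Finsupp.single_eq_of_ne hne)
      subst this
      have := hun x' hxj
      exact ⟨hxj, by omega⟩
  | zero m => exact ⟨0, 0, Fil.zero _, by simp, by simp⟩
  | add m a b _ _ ha hb =>
    obtain ⟨p, α, hp, hα, rfl⟩ := ha hn
    obtain ⟨q, β, hq, hβ, rfl⟩ := hb hn
    refine ⟨p + q, α + β, Fil.add _ _ _ hp hq, ?_, by rw [map_add, map_add]; abel⟩
    intro x hx
    by_cases h : α x = 0
    · apply hβ
      intro h'
      apply hx
      simp [h, h']
    · exact hα x h
  | smul m t a _ ha =>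
    obtain ⟨p, α, hp, hα, rfl⟩ := ha hn
    refine ⟨t • p, t • α, Fil.smul _ _ _ hp, ?_, by rw [map_smul, map_smul, smul_add]⟩
    intro x hx
    apply hα
    intro h'
    apply hx
    simp [h']
  | lie m k l a b h1 h2 h3 ha hb =>
    by_cases hk : k = 0
    · rw [h1.eq_zero hpos hk]
      exact ⟨0, 0, Fil.zero _, by simp, by simp⟩
    by_cases hl : l = 0
    · rw [h2.eq_zero hpos hl]
      exact ⟨0, 0, Fil.zero _, by simp, by simp⟩
    obtain ⟨p, hp, rfl⟩ := low hwt hun h1 (by omega)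
    obtain ⟨q, hq, rfl⟩ := low hwt hun h2 (by omega)
    exact ⟨⁅p, q⁆, 0, Fil.lie _ _ _ _ _ hp hq (by omega), by simp,
      by rw [LieHom.map_lie]; simp⟩

theorem Dat.extend [DecidableEq Y] {w : X → ℕ} {v : Y → ℕ} {y : Y → FreeLieAlgebra K X}
    (hv : ∀ i, 1 ≤ v i) (hs : Star w v y) (M : Finset Y) (e : Y) (he : e ∉ M)
    (d : Dat w (fun i : {i // i ∈ M} => v i) (fun i => y i))
    (z : {i // i ∉ M} → FreeLieAlgebra K d.X') (hz : ∀ i : {i // i ∉ M}, Fil d.w' (v i) (z i))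
    (hzy : ∀ i : {i // i ∉ M}, Fil w (v i - 1) (d.φ (z i) - y i))
    (hun : ∀ x, x ∉ Set.range d.j → v e ≤ d.w' x) :
    ∃ (d : Dat w (fun i : {i // i ∈ insert e M} => v i) (fun i => y i))
      (z : {i // i ∉ insert e M} → FreeLieAlgebra K d.X'), (∀ i : {i // i ∉ insert e M}, Fil d.w' (v i) (z i)) ∧
      (∀ i : {i // i ∉ insert e M}, Fil w (v i - 1) (d.φ (z i) - y i)) := by
  obtain ⟨q, α, hq, hα, hze⟩ := top_part d.pos d.wt hun (hz ⟨e, he⟩) rfl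
  set ζ := z ⟨e, he⟩ with hζ
  have hb : ∃ b, α b ≠ 0 := by
    by_contra hcon
    push Not at hcon
    have hα0 : α = 0 := Finsupp.ext hcon
    rw [hα0, map_zero, add_zero] at hze
    refine hs e (mp Subtype.val q) ?_ ?_
    · exact ((mp_strict (w := fun i : {i // i ∈ M} => v i) (v := v) Subtype.val
        Subtype.val_injective (fun _ => rfl)) _ _).2 hq
    · have h1 := perturb (v := w) (fun i : {i // i ∈ M} => hv i) (d.φ.comp (mp d.j))
        ((lift K (Function.update y e 0)).comp (mp Subtype.val)) ?_ ?_ hq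
      · have h2 := hzy ⟨e, he⟩
        rw [← hζ, hze] at h2
        simp only [LieHom.comp_apply] at h1
        have h3 := h1.sub h2
        convert h3 using 1
        simp only
        rw [sub_sub_sub_cancel_left]
        congr!
      · intro i
        rw [LieHom.comp_apply, mp_of, d.strict]
        exact Fil.of _ _ (d.wt i).le
      · intro i
        rw [LieHom.comp_apply, LieHom.comp_apply, mp_of, mp_of, lift_of_apply,
          Function.update_of_ne (fun h : (i : Y) = e => he (h ▸ i.2))]
        exact d.app i
  obtain ⟨b, hb⟩ := hb
  obtain ⟨hbj, hbw⟩ := hα b hb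
  classical
  -- the complementary part, which does not involve `b`
  set r := mp d.j q + Finsupp.linearCombination K (of K) (α.erase b) with hr
  have hzr : ζ = α b • of K b + r := by
    rw [hze, hr]
    conv_lhs => rw [← Finsupp.single_add_erase b α]
    rw [map_add, Finsupp.linearCombination_single]
    abel
  have hfix : ∀ g : FreeLieAlgebra K d.X' →ₗ⁅K⁆ FreeLieAlgebra K d.X',
      (∀ x, x ≠ b → g (of K x) = of K x) → g r = r := by
    intro g hg
    rw [hr, map_add]
    congr 1
    · have : g.comp (mp d.j) = mp (K := K) d.j := by
        apply FreeLieAlgebra.hom_ext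
        intro i
        rw [LieHom.comp_apply, mp_of, hg]
        rintro h
        exact hbj ⟨i, h⟩
      exact congrArg (fun f : FreeLieAlgebra K {i // i ∈ M} →ₗ⁅K⁆ FreeLieAlgebra K d.X' => f q)
        this
    · rw [Finsupp.linearCombination_apply, Finsupp.sum, map_sum]
      refine Finset.sum_congr rfl fun x hx => ?_
      rw [map_smul, hg]
      intro hxb
      subst hxb
      simp at hx
  have hrf : Fil d.w' (v e) r := by
    have : r = ζ - α b • of K b := by rw [hzr]; abel
    rw [this]
    exact (hz ⟨e, he⟩).sub (Fil.smul _ _ _ (Fil.of _ _ hbw.le))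
  let θ : FreeLieAlgebra K d.X' →ₗ⁅K⁆ FreeLieAlgebra K d.X' :=
    lift K (fun x => if x = b then ζ else of K x)
  let θ' : FreeLieAlgebra K d.X' →ₗ⁅K⁆ FreeLieAlgebra K d.X' :=
    lift K (fun x => if x = b then (α b)⁻¹ • (of K b - r) else of K x)
  have hθb : θ (of K b) = ζ := by simp only [θ]; rw [lift_of_apply, if_pos rfl]
  have hθx : ∀ x, x ≠ b → θ (of K x) = of K x := fun x hx => by
    simp only [θ]; rw [lift_of_apply, if_neg hx]
  have hθ'b : θ' (of K b) = (α b)⁻¹ • (of K b - r) := by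
    simp only [θ']; rw [lift_of_apply, if_pos rfl]
  have hθ'x : ∀ x, x ≠ b → θ' (of K x) = of K x := fun x hx => by
    simp only [θ']; rw [lift_of_apply, if_neg hx]
  have hθf : ∀ x, Fil d.w' (d.w' x) (θ (of K x)) := by
    intro x
    by_cases hx : x = b
    · subst hx; rw [hθb, hbw]; exact hz ⟨e, he⟩
    · rw [hθx x hx]; exact Fil.of _ _ le_rfl
  have hθ'f : ∀ x, Fil d.w' (d.w' x) (θ' (of K x)) := by
    intro x
    by_cases hx : x = b
    · subst hx; rw [hθ'b, hbw]
      exact Fil.smul _ _ _ ((Fil.of _ _ hbw.le).sub hrf)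
    · rw [hθ'x x hx]; exact Fil.of _ _ le_rfl
  have hst : Strict d.w' d.w' θ := by
    refine Strict.of_retract θ θ' hθf hθ'f ?_
    intro x
    by_cases hx : x = b
    · subst hx
      rw [hθb, hzr, map_add, map_smul, hθ'b, hfix θ' hθ'x, smul_smul, mul_inv_cancel₀ hb,
        one_smul]
      abel
    · rw [hθx x hx, hθ'x x hx]
  have hθθ' : ∀ a, θ (θ' a) = a := by
    have : θ.comp θ' = LieHom.id := by
      apply FreeLieAlgebra.hom_ext
      intro x
      rw [LieHom.comp_apply, LieHom.id_apply]
      by_cases hx : x = b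
      · subst hx
        rw [hθ'b, map_smul, map_sub, hθb, hfix θ hθx, hzr, add_sub_cancel_right, smul_smul,
          inv_mul_cancel₀ hb, one_smul]
      · rw [hθ'x x hx, hθx x hx]
    intro a
    exact congrArg (fun f : FreeLieAlgebra K d.X' →ₗ⁅K⁆ FreeLieAlgebra K d.X' => f a) this
  have hmem : ∀ i : {i // i ∈ insert e M}, (i : Y) ∉ M → (i : Y) = e := fun i hi =>
    (Finset.mem_insert.1 i.2).resolve_right hi
  refine ⟨⟨d.X', d.w', d.φ.comp θ, fun i => if h : (i : Y) ∈ M then d.j ⟨i, h⟩ else b,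
    d.pos, d.fin, ?_, ?_, d.strict.comp hst, ?_⟩,
    fun i => θ' (z ⟨i, fun h => i.2 (Finset.mem_insert_of_mem h)⟩), ?_, ?_⟩
  · intro i i' h
    simp only at h
    split_ifs at h with h1 h2 h2
    · have := d.inj h
      simp only [Subtype.mk.injEq] at this
      exact Subtype.ext this
    · exact absurd ⟨_, h⟩ hbj
    · exact absurd ⟨_, h.symm⟩ hbj
    · exact Subtype.ext ((hmem i h1).trans (hmem i' h2).symm)
  · intro i
    split_ifs with h1
    · exact d.wt ⟨i, h1⟩
    · rw [hmem i h1, hbw]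
  · intro i
    simp only [LieHom.comp_apply]
    split_ifs with h1
    · rw [hθx _ (fun h => hbj ⟨_, h⟩)]
      exact d.app ⟨i, h1⟩
    · rw [hθb, hmem i h1]
      exact hzy ⟨e, he⟩
  · intro i
    exact (hz ⟨i, fun h => i.2 (Finset.mem_insert_of_mem h)⟩).map θ' hθ'f
  · intro i
    simp only [LieHom.comp_apply]
    rw [hθθ']
    exact hzy ⟨i, fun h => i.2 (Finset.mem_insert_of_mem h)⟩

theorem exists_dat [Finite X] [Fintype Y] [DecidableEq Y] {w : X → ℕ} {v : Y → ℕ}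
    {y : Y → FreeLieAlgebra K X}
    (hw : ∀ x, 1 ≤ w x) (hv : ∀ i, 1 ≤ v i) (hy : ∀ i, Fil w (v i) (y i)) (hs : Star w v y)
    (k : ℕ) (hk : k ≤ Fintype.card Y) :
    ∃ M : Finset Y, M.card = k ∧
    ∃ (d : Dat w (fun i : {i // i ∈ M} => v i) (fun i => y i))
      (z : {i // i ∉ M} → FreeLieAlgebra K d.X'), (∀ i : {i // i ∉ M}, Fil d.w' (v i) (z i)) ∧
      (∀ i : {i // i ∉ M}, Fil w (v i - 1) (d.φ (z i) - y i)) := by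
  induction k with
  | zero =>
    refine ⟨∅, rfl, ⟨X, w, LieHom.id, fun i => absurd i.2 (Finset.notMem_empty _), hw,
      fun n => Set.toFinite _, fun i => absurd i.2 (Finset.notMem_empty _),
      fun i => absurd i.2 (Finset.notMem_empty _), fun _ _ => Iff.rfl,
      fun i => absurd i.2 (Finset.notMem_empty _)⟩, fun i => y i, fun i => hy i, fun i => ?_⟩
    simpa using Fil.zero _
  | succ k ih =>
    obtain ⟨M, hM, d, z, hz, hzy⟩ := ih (by omega)
    have hne : (Finset.univ \ M).Nonempty := by
      rw [← Finset.card_pos, Finset.card_sdiff_of_subset (Finset.subset_univ _), Finset.card_univ]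
      omega
    obtain ⟨e, he, hmin⟩ := Finset.exists_min_image _ v hne
    have he' : e ∉ M := (Finset.mem_sdiff.1 he).2
    obtain ⟨d, z, hz, hzy, hun⟩ := Dat.loop (V := v e) (u := fun i : {i // i ∉ M} => v i)
      (ye := fun i => y i)
      (fun i => hmin i (Finset.mem_sdiff.2 ⟨Finset.mem_univ _, i.2⟩)) ⟨d, z, hz, hzy⟩ (v e) le_rfl
    exact ⟨insert e M, by rw [Finset.card_insert_of_notMem he', hM],
      Dat.extend hv hs M e he' d z hz hzy hun⟩

theorem strict_finite [Finite X] [Finite Y] {w : X → ℕ} {v : Y → ℕ}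
    {y : Y → FreeLieAlgebra K X}
    (hw : ∀ x, 1 ≤ w x) (hv : ∀ i, 1 ≤ v i) (hy : ∀ i, Fil w (v i) (y i)) (hs : Star w v y) :
    Strict v w (lift K y) := by
  classical
  have := Fintype.ofFinite Y
  obtain ⟨M, hM, d, -⟩ := exists_dat hw hv hy hs _ le_rfl
  have hMu : M = Finset.univ := Finset.card_eq_iff_eq_univ M |>.1 hM
  subst hMu
  have h0 := Dat.strict_of (v := fun i : {i : Y // i ∈ (Finset.univ : Finset Y)} => v i) (fun i => hv i) d
  have h1 := h0.comp
    (mp_strict (w := v) (v := fun i : {i : Y // i ∈ (Finset.univ : Finset Y)} => v i) (fun i : Y => (⟨i, Finset.mem_univ i⟩ : {i : Y // i ∈ (Finset.univ : Finset Y)}))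
      (fun i i' h => by simpa using h) (fun _ => rfl))
  convert h1 using 1
  apply FreeLieAlgebra.hom_ext
  intro i
  rw [LieHom.comp_apply, mp_of, lift_of_apply, lift_of_apply]

theorem exists_supp (a : FreeLieAlgebra K X) :
    ∃ s : Finset X, ∀ t : Finset X, s ⊆ t →
      ∃ p : FreeLieAlgebra K {x // x ∈ t}, mp Subtype.val p = a := by
  classical
  induction a using free_ind with
  | hof x =>
    exact ⟨{x}, fun t ht => ⟨of K ⟨x, ht (Finset.mem_singleton_self x)⟩, mp_of _ _⟩⟩
  | h0 => exact ⟨∅, fun t _ => ⟨0, map_zero _⟩⟩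
  | hadd a b ha hb =>
    obtain ⟨s, hs⟩ := ha
    obtain ⟨s', hs'⟩ := hb
    refine ⟨s ∪ s', fun t ht => ?_⟩
    obtain ⟨p, hp⟩ := hs t (Finset.union_subset_left ht)
    obtain ⟨q, hq⟩ := hs' t (Finset.union_subset_right ht)
    exact ⟨p + q, by rw [map_add, hp, hq]⟩
  | hsmul c a ha =>
    obtain ⟨s, hs⟩ := ha
    refine ⟨s, fun t ht => ?_⟩
    obtain ⟨p, hp⟩ := hs t ht
    exact ⟨c • p, by rw [map_smul, hp]⟩
  | hlie a b ha hb =>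
    obtain ⟨s, hs⟩ := ha
    obtain ⟨s', hs'⟩ := hb
    refine ⟨s ∪ s', fun t ht => ?_⟩
    obtain ⟨p, hp⟩ := hs t (Finset.union_subset_left ht)
    obtain ⟨q, hq⟩ := hs' t (Finset.union_subset_right ht)
    exact ⟨⁅p, q⁆, by rw [LieHom.map_lie, hp, hq]⟩

theorem strict_finite' [Finite Y] {w : X → ℕ} {v : Y → ℕ}
    {y : Y → FreeLieAlgebra K X}
    (hw : ∀ x, 1 ≤ w x) (hv : ∀ i, 1 ≤ v i) (hy : ∀ i, Fil w (v i) (y i)) (hs : Star w v y) :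
    Strict v w (lift K y) := by
  classical
  have := Fintype.ofFinite Y
  choose s hs' using fun i => exists_supp (y i)
  let t : Finset X := Finset.univ.biUnion s
  choose y0 hy0 using fun i => hs' i t (Finset.subset_biUnion_of_mem s (Finset.mem_univ i))
  have hst : Strict (K := K) (fun x : {x // x ∈ t} => w x) w (mp Subtype.val) :=
    mp_strict _ Subtype.val_injective (fun _ => rfl)
  have hcomp : ∀ y0' : Y → FreeLieAlgebra K {x // x ∈ t},
      (mp Subtype.val).comp (lift K y0') = lift K (fun i => mp (K := K) Subtype.val (y0' i)) := by
    intro y0'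
    apply FreeLieAlgebra.hom_ext
    intro i
    rw [LieHom.comp_apply, lift_of_apply, lift_of_apply]
  have h1 : Strict v (fun x : {x // x ∈ t} => w x) (lift K y0) := by
    refine strict_finite (fun x => hw x) hv (fun i => ?_) ?_
    · rw [← hst, hy0]; exact hy i
    · intro e q hq hh
      refine hs e q hq ?_
      rw [← hst, map_sub, hy0] at hh
      have h2 := congrArg (fun f : FreeLieAlgebra K Y →ₗ⁅K⁆ FreeLieAlgebra K X => f q)
        (hcomp (Function.update y0 e 0))
      simp only [LieHom.comp_apply] at h2
      have h3 : (fun i => mp (K := K) Subtype.val (Function.update y0 e 0 i)) =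
          Function.update y e 0 := by
        funext i
        by_cases hi : i = e
        · subst hi; simp
        · rw [Function.update_of_ne hi, Function.update_of_ne hi, hy0]
      rw [h3] at h2
      have hh' : Fil w (v e - 1) (y e - lift K (Function.update y e 0) q) := by
        rw [← h2]
        convert hh
      convert hh'
  have h2 := hst.comp h1
  rw [hcomp] at h2
  simpa only [hy0] using h2

theorem strict_all {w : X → ℕ} {v : Y → ℕ} {y : Y → FreeLieAlgebra K X}
    (hw : ∀ x, 1 ≤ w x) (hv : ∀ i, 1 ≤ v i) (hy : ∀ i, Fil w (v i) (y i)) (hs : Star w v y) :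
    Strict v w (lift K y) := by
  intro n a
  refine ⟨fun h => ?_, fun h => h.map _ (fun i => by rw [lift_of_apply]; exact hy i)⟩
  obtain ⟨s, hs'⟩ := exists_supp a
  obtain ⟨p, rfl⟩ := hs' s (Finset.Subset.refl _)
  have h1 : Strict (fun i : {i // i ∈ s} => v i) w (lift K (fun i : {i // i ∈ s} => y i)) :=
    strict_finite' hw (fun i => hv i) (fun i => hy i)
      (hs.comp Subtype.val Subtype.val_injective)
  have h2 : (lift K y).comp (mp (K := K) Subtype.val) = lift K (fun i : {i // i ∈ s} => y i) := by
    apply FreeLieAlgebra.hom_ext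
    intro i
    rw [LieHom.comp_apply, mp_of, lift_of_apply, lift_of_apply]
  rw [mp_strict (w := fun i : {i // i ∈ s} => v i) (v := v) Subtype.val
    Subtype.val_injective (fun _ => rfl), ← h1, ← h2]
  exact h
end main

section final
variable {X : Type}

/-- `Fil` as a submodule. -/
def FilSub (w : X → ℕ) (n : ℕ) : Submodule K (FreeLieAlgebra K X) where
  carrier := {a | Fil w n a}
  add_mem' := fun {a b} ha hb => Fil.add n a b ha hb
  zero_mem' := Fil.zero n
  smul_mem' := fun t a ha => Fil.smul n t a ha

theorem shirshov_witt (R : LieSubalgebra K (FreeLieAlgebra K X)) :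
    ∃ (Y : Type) (y : Y → FreeLieAlgebra K X), (∀ i, y i ∈ R) ∧
      Function.Injective (lift K y) ∧ ∀ h ∈ R, ∃ p, lift K y p = h := by
  classical
  let w : X → ℕ := fun _ => 1
  have hw : ∀ x, 1 ≤ w x := fun _ => le_rfl
  let A : ℕ → Submodule K (FreeLieAlgebra K X) := fun n => R.toSubmodule ⊓ FilSub w (n + 1)
  let D : ℕ → LieSubalgebra K (FreeLieAlgebra K X) := fun n =>
    LieSubalgebra.lieSpan K _ {a | a ∈ R ∧ Fil w n a}
  let E : ℕ → Submodule K (FreeLieAlgebra K X) := fun n => (D n).toSubmodule ⊔ FilSub w n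
  let Q : ∀ n, Submodule K (FreeLieAlgebra K X ⧸ E n) := fun n => (A n).map (E n).mkQ
  let bs := fun n => Module.Basis.ofVectorSpace K (Q n)
  let Y : Type := Σ n : ℕ, Module.Basis.ofVectorSpaceIndex K (Q n)
  have hex : ∀ i : Y, ∃ a, a ∈ A i.1 ∧ (E i.1).mkQ a = (bs i.1 i.2 : FreeLieAlgebra K X ⧸ E i.1) :=
    fun i => (Submodule.mem_map).1 (bs i.1 i.2).2
  choose y hyA hyb using hex
  let v : Y → ℕ := fun i => i.1 + 1
  have hv : ∀ i, 1 ≤ v i := fun i => Nat.le_add_left _ _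
  have hyR : ∀ i, y i ∈ R := fun i => (hyA i).1
  have hyF : ∀ i, Fil w (v i) (y i) := fun i => (hyA i).2
  have hliftR : ∀ y' : Y → FreeLieAlgebra K X, (∀ i, y' i ∈ R) → ∀ p, lift K y' p ∈ R := by
    intro y' hy' p
    induction p using free_ind with
    | hof x => rw [lift_of_apply]; exact hy' x
    | h0 => rw [map_zero]; exact R.zero_mem
    | hadd a b ha hb => rw [map_add]; exact R.add_mem ha hb
    | hsmul t a ha => rw [map_smul]; exact R.smul_mem t ha
    | hlie a b ha hb => rw [LieHom.map_lie]; exact R.lie_mem ha hb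
  have hstar : Star w v y := by
    rintro ⟨n, i⟩ q hq hh
    set y' : Y → FreeLieAlgebra K X := Function.update y ⟨n, i⟩ 0 with hy'
    have hy'R : ∀ k, y' k ∈ R := by
      intro k
      by_cases hk : k = ⟨n, i⟩
      · subst hk; rw [hy', Function.update_self]; exact R.zero_mem
      · rw [hy', Function.update_of_ne hk]; exact hyR k
    have hy'F : ∀ k, Fil w (v k) (y' k) := by
      intro k
      by_cases hk : k = ⟨n, i⟩
      · subst hk; rw [hy', Function.update_self]; exact Fil.zero _
      · rw [hy', Function.update_of_ne hk]; exact hyF k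
    have key : ∀ m q, Fil v m q → m ≤ n + 1 → lift K y' q ∈
        Submodule.span K ((fun k => y ⟨n, k⟩) '' {i}ᶜ) ⊔ (D n).toSubmodule := by
      intro m q hq
      induction hq with
      | of m x hx =>
        intro hm
        rw [lift_of_apply]
        by_cases hk : x = ⟨n, i⟩
        · subst hk; rw [hy', Function.update_self]; exact Submodule.zero_mem _
        · by_cases hxn : x.1 = n
          · apply Submodule.mem_sup_left
            rw [hy', Function.update_of_ne hk]
            obtain ⟨n', k⟩ := x
            simp only at hxn
            subst hxn
            refine Submodule.subset_span ⟨k, ?_, rfl⟩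
            rintro rfl
            exact hk rfl
          · apply Submodule.mem_sup_right
            refine LieSubalgebra.subset_lieSpan ⟨hy'R x, (hy'F x).mono ?_⟩
            have : v x = x.1 + 1 := rfl
            omega
      | zero m => intro _; rw [map_zero]; exact Submodule.zero_mem _
      | add m a b _ _ ha hb =>
        intro hm; rw [map_add]; exact Submodule.add_mem _ (ha hm) (hb hm)
      | smul m t a _ ha => intro hm; rw [map_smul]; exact Submodule.smul_mem _ _ (ha hm)
      | lie m k l a b h1 h2 h3 ha hb =>
        intro hm
        by_cases hk : k = 0
        · rw [h1.eq_zero hv hk, zero_lie, map_zero]; exact Submodule.zero_mem _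
        by_cases hl : l = 0
        · rw [h2.eq_zero hv hl, lie_zero, map_zero]; exact Submodule.zero_mem _
        apply Submodule.mem_sup_right
        rw [LieHom.map_lie]
        have hmp : ∀ k a, Fil v k a → k ≤ n → lift K y' a ∈ D n := fun k a h hk =>
          LieSubalgebra.subset_lieSpan ⟨hliftR y' hy'R a,
            (h.map (lift K y') (fun x => by rw [lift_of_apply]; exact hy'F x)).mono hk⟩
        exact (D n).lie_mem (hmp k a h1 (by omega)) (hmp l b h2 (by omega))
    have h1 := key _ q hq le_rfl
    have h2 : y ⟨n, i⟩ ∈ Submodule.span K ((fun k => y ⟨n, k⟩) '' {i}ᶜ) ⊔ E n := by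
      have h3 : y ⟨n, i⟩ - lift K y' q ∈ E n := Submodule.mem_sup_right (by
        have : Fil w n (y ⟨n, i⟩ - lift K y' q) := by
          convert hh
          rfl
        exact this)
      have h4 := Submodule.add_mem _
        ((sup_le_sup_left (le_sup_left : _ ≤ E n) _) h1) (Submodule.mem_sup_right h3)
      simpa using h4
    have h3 : (E n).mkQ (y ⟨n, i⟩) ∈ Submodule.span K
        ((fun k => (bs n k : FreeLieAlgebra K X ⧸ E n)) '' {i}ᶜ) := by
      have h4 := Submodule.mem_map_of_mem (f := (E n).mkQ) h2
      rw [Submodule.map_sup, Submodule.mkQ_map_self, sup_bot_eq, Submodule.map_span,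
        Set.image_image] at h4
      have heq : (fun k => (bs n k : FreeLieAlgebra K X ⧸ E n)) =
          (fun x => (E n).mkQ (y ⟨n, x⟩)) := funext fun k => (hyb ⟨n, k⟩).symm
      rw [heq]
      exact h4
    rw [hyb ⟨n, i⟩] at h3
    have hli : LinearIndependent K (fun k => (bs n k : FreeLieAlgebra K X ⧸ E n)) :=
      (bs n).linearIndependent.map' (Q n).subtype (Submodule.ker_subtype _)
    exact hli.notMem_span_image (s := {i}ᶜ) (x := i) (by simp) h3
  refine ⟨Y, y, hyR, (strict_all hw hv hyF hstar).injective hv, ?_⟩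
  have hgen : ∀ n h, h ∈ R → Fil w n h → h ∈ (lift K y).range := by
    intro n
    induction n with
    | zero =>
      intro h _ hh
      rw [hh.eq_zero hw rfl]
      exact LieSubalgebra.zero_mem _
    | succ n ih =>
      intro h hR hF
      have h1 : (E n).mkQ h ∈ Q n := Submodule.mem_map_of_mem ⟨hR, hF⟩
      have h2 : (E n).mkQ h ∈ Submodule.map (E n).mkQ
          (Submodule.span K (Set.range fun k => y ⟨n, k⟩)) := by
        have h3 : (⟨_, h1⟩ : Q n) ∈ Submodule.span K (Set.range (bs n)) := by
          rw [(bs n).span_eq]; trivial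
        have h4 := Submodule.mem_map_of_mem (f := (Q n).subtype) h3
        rw [Submodule.map_span, ← Set.range_comp] at h4
        rw [Submodule.map_span, ← Set.range_comp]
        have heq : (⇑(E n).mkQ ∘ fun k => y ⟨n, k⟩) = (⇑(Q n).subtype ∘ ⇑(bs n)) :=
          funext fun k => hyb ⟨n, k⟩
        rw [heq]
        exact h4
      obtain ⟨c, hc, hch⟩ := h2
      have hcr : c ∈ R ∧ c ∈ (lift K y).range := by
        have : Submodule.span K (Set.range fun k => y ⟨n, k⟩) ≤
            R.toSubmodule ⊓ (lift K y).range.toSubmodule := by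
          rw [Submodule.span_le]
          rintro _ ⟨k, rfl⟩
          refine ⟨hyR _, ?_⟩
          exact (LieHom.mem_range _ _).2 ⟨of K ⟨n, k⟩, lift_of_apply _ _⟩
        exact this hc
      have h5 : h - c ∈ E n := by
        rw [← Submodule.ker_mkQ (E n), LinearMap.mem_ker, map_sub, hch, sub_self]
      obtain ⟨d, hd, f, hf, hdf⟩ := Submodule.mem_sup.1 h5
      have hDR : D n ≤ R := LieSubalgebra.lieSpan_le.2 fun a ha => ha.1
      have hDr : D n ≤ (lift K y).range := LieSubalgebra.lieSpan_le.2 fun a ha => ih a ha.1 ha.2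
      have hfe : f = h - c - d := by rw [← hdf]; abel
      have hfr : f ∈ (lift K y).range := by
        refine ih f ?_ hf
        rw [hfe]
        exact R.sub_mem (R.sub_mem hR hcr.1) (hDR hd)
      have : h = c + (d + f) := by rw [hdf]; abel
      rw [this]
      exact LieSubalgebra.add_mem _ hcr.2 (LieSubalgebra.add_mem _ (hDr hd) hfr)
  intro h hR
  obtain ⟨n, hn⟩ := Fil.exists w h
  exact (LieHom.mem_range _ _).1 (hgen n h hR hn)
end final

end SW

theorem stmt18 (K : Type) [Field K] (X : Type) [Nonempty X]
    (R : LieIdeal K (FreeLieAlgebra K X)) (hR : R ≠ ⊥) :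
    ∃ Y : Type, Nonempty (R ≃ₗ⁅K⁆ FreeLieAlgebra K Y) := by
  obtain ⟨Y, y, hyR, hinj, hsurj⟩ := SW.shirshov_witt (K := K)
    (LieIdeal.toLieSubalgebra K (FreeLieAlgebra K X) R)
  let g : FreeLieAlgebra K Y →ₗ⁅K⁆ R := FreeLieAlgebra.lift K (fun i => (⟨y i, hyR i⟩ : R))
  have hg : ∀ p, ((g p : R) : FreeLieAlgebra K X) = FreeLieAlgebra.lift K y p := by
    intro p
    induction p using SW.free_ind with
    | hof x => simp only [g]; rw [FreeLieAlgebra.lift_of_apply, FreeLieAlgebra.lift_of_apply]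
    | h0 => simp
    | hadd a b ha hb => rw [map_add, map_add, ← ha, ← hb]; rfl
    | hsmul t a ha => rw [map_smul, map_smul, ← ha]; rfl
    | hlie a b ha hb => rw [LieHom.map_lie, LieHom.map_lie, ← ha, ← hb]; rfl
  have hb : Function.Bijective g := by
    constructor
    · intro p q h
      apply hinj
      rw [← hg, ← hg, h]
    · rintro ⟨a, ha⟩
      obtain ⟨p, hp⟩ := hsurj a ha
      exact ⟨p, Subtype.ext ((hg p).trans hp)⟩
  exact ⟨Y, ⟨(LieEquiv.ofBijective g hb).symm⟩⟩
end
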